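/- arXiv:1709.08504 — 5 statements merged into one kernel-verified Lean document; each statement's English description precedes it below -/
import Mathlib

section
/- Fix an integer m ≥ 2 and let α > 2 or α = 1. For each n, let κ = (k₁,…,k_m) ∈ 𝒫_n(m) be chosen with probability proportional to f(k₁/n,…,k_m/n), where f(x₁,…,x_m) = c·x₁^{α−1}···x_m^{α−1} with 1/c = ∫_{∇_{m−1}} y₁^{α−1}···y_m^{α−1} dy₁…dy_{m−1}. Then as n → ∞, (k₁/n,…,k_m/n) converges weakly to (X_{(1)},…,X_{(m)}), the decreasing order statistics of a random vector (X₁,…,X_m) with the symmetric Dirichlet distribution Dir(α). -/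
open scoped BigOperators
open MeasureTheory

/-- The ordered `(m-1)`-dimensional simplex `∇_{m-1}`. -/
def openSimplex (m : ℕ) : Set (Fin m → ℝ) :=
  {y | (∀ i, y i ∈ Set.Icc (0 : ℝ) 1) ∧ StrictAnti y ∧ ∑ i, y i = 1}

/-- Extension of a vector of the first `m-1` coordinates to a vector of `m` coordinates,
the last one being `1` minus the sum of the others. -/
noncomputable def extLast (m : ℕ) (y : Fin (m - 1) → ℝ) : Fin m → ℝ :=
  fun i => if h : (i : ℕ) < m - 1 then y ⟨i, h⟩ else 1 - ∑ k, y k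

/-- The rescaled partition `(k₁/n, …, k_m/n)`. -/
noncomputable def scaled (n : ℕ) {m : ℕ} (k : Fin m → ℕ) : Fin m → ℝ :=
  fun i => (k i : ℝ) / n

/-- The decreasing rearrangement (decreasing order statistics) of a vector. -/
noncomputable def dsort {m : ℕ} (x : Fin m → ℝ) : Fin m → ℝ :=
  fun i => x (Tuple.sort x (Fin.rev i))

section ExtLast

variable {d : ℕ}

theorem extLast_castSucc (y : Fin d → ℝ) (i : Fin d) :
    extLast (d + 1) y i.castSucc = y i := by
  simp [extLast]

theorem extLast_last (y : Fin d → ℝ) :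
    extLast (d + 1) y (Fin.last d) = 1 - ∑ k, y k := by
  simp [extLast]

theorem sum_extLast (y : Fin d → ℝ) : ∑ i, extLast (d + 1) y i = 1 := by
  rw [Fin.sum_univ_castSucc]
  simp [extLast_castSucc, extLast_last]

theorem extLast_comp_castSucc {x : Fin (d + 1) → ℝ} (hx : ∑ i, x i = 1) :
    extLast (d + 1) (fun i : Fin d => x i.castSucc) = x := by
  funext i
  induction i using Fin.lastCases with
  | last =>
    rw [extLast_last, ← hx, Fin.sum_univ_castSucc]
    ring
  | cast i => rw [extLast_castSucc]

theorem continuous_extLast : Continuous (fun y : Fin d → ℝ => extLast (d + 1) y) := by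
  refine continuous_pi fun i => ?_
  induction i using Fin.lastCases with
  | last => simp only [extLast_last]; fun_prop
  | cast i => simp only [extLast_castSucc]; fun_prop

theorem extLast_combo (y z : Fin d → ℝ) {a b : ℝ} (hab : a + b = 1) :
    extLast (d + 1) (a • y + b • z) = a • extLast (d + 1) y + b • extLast (d + 1) z := by
  funext i
  induction i using Fin.lastCases with
  | last =>
    simp only [extLast_last, Pi.add_apply, Pi.smul_apply, smul_eq_mul, Finset.sum_add_distrib,
      ← Finset.mul_sum]
    linear_combination -hab
  | cast i => simp [extLast_castSucc]

/-- Two fixed coordinates of `extLast (d + 1) y` differ for almost every `y`. -/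
theorem volume_extLast_tie {i j : Fin (d + 1)} (hij : i ≠ j) :
    volume {y : Fin d → ℝ | extLast (d + 1) y i = extLast (d + 1) y j} = 0 := by
  let S : AffineSubspace ℝ (Fin d → ℝ) :=
    { carrier := {y : Fin d → ℝ | extLast (d + 1) y i = extLast (d + 1) y j}
      smul_vsub_vadd_mem' := by
        intro c p q r hp hq hr
        have key : ∀ l, extLast (d + 1) (c • (p -ᵥ q) +ᵥ r) l =
            c * (extLast (d + 1) p l - extLast (d + 1) q l) + extLast (d + 1) r l := by
          intro l
          induction l using Fin.lastCases with
          | last =>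
            simp only [extLast_last, vsub_eq_sub, vadd_eq_add, Pi.add_apply, Pi.smul_apply,
              Pi.sub_apply, smul_eq_mul, Finset.sum_add_distrib, ← Finset.mul_sum,
              Finset.sum_sub_distrib]
            ring
          | cast l => simp [extLast_castSucc]
        simp only [Set.mem_ofPred_eq] at hp hq hr ⊢
        rw [key, key, hp, hq, hr] }
  refine Measure.addHaar_affineSubspace volume S fun h => ?_
  have hx : ∑ l, (Pi.single i 1 : Fin (d + 1) → ℝ) l = 1 := by simp
  have hmem : (fun l : Fin d => (Pi.single i 1 : Fin (d + 1) → ℝ) l.castSucc) ∈ S := by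
    rw [h]; trivial
  have hmem' : extLast (d + 1) (fun l : Fin d => (Pi.single i 1 : Fin (d + 1) → ℝ) l.castSucc) i =
    extLast (d + 1) (fun l : Fin d => (Pi.single i 1 : Fin (d + 1) → ℝ) l.castSucc) j := hmem
  rw [extLast_comp_castSucc hx] at hmem'
  simp [hij.symm] at hmem'

end ExtLast

/-- The solid simplex parametrizing probability vectors by all coordinates but the last. -/
def solidSimplex (d : ℕ) : Set (Fin d → ℝ) :=
  {y | (∀ i, 0 ≤ y i) ∧ ∑ i, y i ≤ 1}

/-- The part of the solid simplex on which `σ` sorts the coordinates decreasingly. -/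
def sortedCell (d : ℕ) (σ : Equiv.Perm (Fin (d + 1))) : Set (Fin d → ℝ) :=
  {y | y ∈ solidSimplex d ∧ Antitone (extLast (d + 1) y ∘ σ)}

section Cells

variable {d : ℕ}

theorem mem_solidSimplex_iff {y : Fin d → ℝ} :
    y ∈ solidSimplex d ↔ ∀ i, 0 ≤ extLast (d + 1) y i := by
  rw [Fin.forall_fin_succ']
  simp [solidSimplex, extLast_castSucc, extLast_last]

theorem solidSimplex_subset_Icc : solidSimplex d ⊆ Set.Icc 0 1 := fun _ hy =>
  ⟨hy.1, fun i => (Finset.single_le_sum (fun j _ => hy.1 j) (Finset.mem_univ i)).trans hy.2⟩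

theorem isCompact_sortedCell (σ : Equiv.Perm (Fin (d + 1))) : IsCompact (sortedCell d σ) := by
  refine isCompact_Icc.of_isClosed_subset ?_ fun _ hy => solidSimplex_subset_Icc hy.1
  have hc : ∀ i, Continuous fun y : Fin d → ℝ => extLast (d + 1) y i :=
    fun i => (continuous_apply i).comp continuous_extLast
  simp only [sortedCell, mem_solidSimplex_iff, Antitone, Set.ofPred_and, Set.ofPred_forall,
    Function.comp_apply]
  exact (isClosed_iInter fun i => isClosed_le continuous_const (hc i)).inter
    (isClosed_iInter fun i => isClosed_iInter fun j => isClosed_iInter fun _ =>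
      isClosed_le (hc _) (hc _))

theorem convex_sortedCell (σ : Equiv.Perm (Fin (d + 1))) : Convex ℝ (sortedCell d σ) := by
  intro y hy z hz a b ha hb hab
  simp only [sortedCell, mem_solidSimplex_iff, Set.mem_ofPred_eq, extLast_combo y z hab] at hy hz ⊢
  refine ⟨fun i => ?_, fun i j hij => ?_⟩
  · have := hy.1 i
    have := hz.1 i
    simp only [Pi.add_apply, Pi.smul_apply, smul_eq_mul]
    positivity
  · have := hy.2 hij
    have := hz.2 hij
    simp only [Function.comp_apply, Pi.add_apply, Pi.smul_apply, smul_eq_mul] at *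
    gcongr

theorem antitone_dsort {m : ℕ} (x : Fin m → ℝ) : Antitone (dsort x) :=
  fun _ _ h => Tuple.monotone_sort x (Fin.rev_le_rev.mpr h)

theorem dsort_eq_of_antitone {m : ℕ} {x : Fin m → ℝ} {σ : Equiv.Perm (Fin m)}
    (h : Antitone (x ∘ σ)) : dsort x = x ∘ σ :=
  Tuple.unique_antitone (σ := Fin.revPerm.trans (Tuple.sort x)) (antitone_dsort x) h

theorem iUnion_sortedCell : ⋃ σ, sortedCell d σ = solidSimplex d := by
  ext y
  simp only [Set.mem_iUnion, sortedCell, Set.mem_ofPred_eq]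
  refine ⟨fun ⟨_, h⟩ => h.1, fun h =>
    ⟨Fin.revPerm.trans (Tuple.sort (extLast (d + 1) y)), h, antitone_dsort _⟩⟩

theorem aedisjoint_sortedCell :
    Pairwise (Function.onFun (AEDisjoint (volume : Measure (Fin d → ℝ))) (sortedCell d)) := by
  intro σ τ hστ
  obtain ⟨l, hl⟩ : ∃ l, σ l ≠ τ l := by
    by_contra! h
    exact hστ (Equiv.ext h)
  refine measure_mono_null (fun _ hy => ?_) (volume_extLast_tie hl)
  exact congrFun (Tuple.unique_antitone hy.1.2 hy.2.2) l

theorem integrableOn_sortedCell_dsort (σ : Equiv.Perm (Fin (d + 1))) {F : (Fin (d + 1) → ℝ) → ℝ}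
    (hF : Continuous F) :
    IntegrableOn (fun y : Fin d → ℝ => F (dsort (extLast (d + 1) y))) (sortedCell d σ) := by
  have hcont : Continuous fun y : Fin d → ℝ => F (extLast (d + 1) y ∘ σ) :=
    hF.comp (continuous_pi fun i => (continuous_apply (σ i)).comp continuous_extLast)
  refine (hcont.continuousOn.integrableOn_compact (isCompact_sortedCell σ)).congr_fun
    (fun y hy => ?_) (isCompact_sortedCell σ).measurableSet
  simp only [dsort_eq_of_antitone hy.2]

end Cells

section RiemannSum

open Pointwise

variable {d : ℕ}

theorem sum_scaled {m n : ℕ} (hn : n ≠ 0) {k : Fin m → ℕ} (hk : ∑ i, k i = n) :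
    ∑ i, scaled n k i = 1 := by
  simp only [scaled, ← Finset.sum_div]
  rw [← Nat.cast_sum, hk, div_self (Nat.cast_ne_zero.mpr hn)]

theorem extLast_scaled {n : ℕ} (hn : n ≠ 0) {k : Fin (d + 1) → ℕ} (hk : ∑ i, k i = n) :
    extLast (d + 1) (fun i : Fin d => scaled n k i.castSucc) = scaled n k :=
  extLast_comp_castSucc (sum_scaled hn hk)

theorem sum_comp_perm_symm {m : ℕ} (σ : Equiv.Perm (Fin m)) (k : Fin m → ℕ) :
    ∑ i, (k ∘ σ.symm) i = ∑ i, k i :=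
  Equiv.sum_comp σ.symm k

/-- Lattice points of a sorted cell correspond to partitions. -/
theorem tsum_partition_eq_tsum_lattice (σ : Equiv.Perm (Fin (d + 1))) {n : ℕ} (hn : n ≠ 0)
    (F : (Fin (d + 1) → ℝ) → ℝ) :
    ∑' x : ↑(sortedCell d σ ∩ (n : ℝ)⁻¹ •
        (Submodule.span ℤ (Set.range (Pi.basisFun ℝ (Fin d))) : Set (Fin d → ℝ))),
      F (extLast (d + 1) x.1 ∘ σ) =
    ∑' κ : {k : Fin (d + 1) → ℕ // Antitone k ∧ ∑ i, k i = n}, F (scaled n κ.1) := by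
  have : NeZero n := ⟨hn⟩
  have hn' : (n : ℝ) ≠ 0 := Nat.cast_ne_zero.mpr hn
  have hext : ∀ κ : {k : Fin (d + 1) → ℕ // Antitone k ∧ ∑ i, k i = n},
      extLast (d + 1) (fun i : Fin d => scaled n (κ.1 ∘ σ.symm) i.castSucc) =
        scaled n (κ.1 ∘ σ.symm) := fun κ =>
    extLast_scaled hn ((sum_comp_perm_symm σ κ.1).trans κ.2.2)
  have hcomp : ∀ k : Fin (d + 1) → ℕ, scaled n (k ∘ σ.symm) ∘ σ = scaled n k := by
    intro k
    funext i
    simp [scaled]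
  let e : {k : Fin (d + 1) → ℕ // Antitone k ∧ ∑ i, k i = n} →
      ↑(sortedCell d σ ∩ (n : ℝ)⁻¹ •
        (Submodule.span ℤ (Set.range (Pi.basisFun ℝ (Fin d))) : Set (Fin d → ℝ))) := fun κ =>
    ⟨fun i : Fin d => scaled n (κ.1 ∘ σ.symm) i.castSucc, by
      refine ⟨⟨?_, ?_⟩, ?_⟩
      · rw [mem_solidSimplex_iff, hext]
        intro i
        simp only [scaled]
        positivity
      · rw [hext, hcomp]
        intro i j hij
        simp only [scaled]
        have := κ.2.1 hij
        gcongr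
      · rw [← Submodule.coe_pointwise_smul, SetLike.mem_coe,
          BoxIntegral.unitPartition.mem_smul_span_iff]
        intro i
        refine ⟨((κ.1 ∘ σ.symm) i.castSucc : ℕ), ?_⟩
        simp only [scaled]
        rw [mul_div_cancel₀ _ hn']
        simp⟩
  have he : Function.Bijective e := by
    constructor
    · intro κ κ' h
      have h1 : (e κ).1 = (e κ').1 := congrArg Subtype.val h
      have h2 := congrArg (fun y : Fin d → ℝ => extLast (d + 1) y ∘ σ) h1
      simp only [e, hext, hcomp] at h2
      refine Subtype.ext (funext fun i => ?_)
      have h3 := congrFun h2 i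
      simp only [scaled] at h3
      exact_mod_cast (div_left_inj' hn').mp h3
    · rintro ⟨y, ⟨hy, hanti⟩, hlat⟩
      rw [← Submodule.coe_pointwise_smul, SetLike.mem_coe,
          BoxIntegral.unitPartition.mem_smul_span_iff] at hlat
      rw [mem_solidSimplex_iff] at hy
      have hnat : ∀ i, ∃ a : ℕ, (a : ℝ) = n * extLast (d + 1) y i := by
        have hint : ∀ i, ∃ a : ℤ, (a : ℝ) = n * extLast (d + 1) y i := by
          intro i
          induction i using Fin.lastCases with
          | last =>
            choose a ha using hlat
            refine ⟨n - ∑ i, a i, ?_⟩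
            simp only [eq_intCast] at ha
            rw [extLast_last, mul_sub, Finset.mul_sum]
            push_cast
            simp [ha]
          | cast i =>
            rw [extLast_castSucc]
            exact hlat i
        intro i
        obtain ⟨a, ha⟩ := hint i
        have h0 : (0 : ℝ) ≤ a := by
          rw [ha]
          exact mul_nonneg (Nat.cast_nonneg _) (hy i)
        lift a to ℕ using by exact_mod_cast h0
        exact ⟨a, by exact_mod_cast ha⟩
      choose a ha using hnat
      have hsc : scaled n a = extLast (d + 1) y := by
        funext i
        simp only [scaled]
        rw [ha, mul_div_cancel_left₀ _ hn']
      refine ⟨⟨a ∘ σ, fun i j hij => ?_, ?_⟩, ?_⟩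
      · have h1 := mul_le_mul_of_nonneg_left (hanti hij) (Nat.cast_nonneg (α := ℝ) n)
        simp only [Function.comp_apply, ← ha] at h1 ⊢
        exact_mod_cast h1
      · have h1 : ∑ i, (a ∘ σ) i = ∑ i, a i := Equiv.sum_comp σ a
        rw [h1]
        have h2 : (∑ i, (a i : ℝ)) = n := by
          simp only [ha, ← Finset.mul_sum, sum_extLast, mul_one]
        exact_mod_cast h2
      · refine Subtype.ext (funext fun i => ?_)
        have h1 : (a ∘ σ) ∘ σ.symm = a := by funext i; simp
        simp only [e, h1, hsc, extLast_castSucc]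
  rw [← (Equiv.ofBijective e he).tsum_eq]
  refine tsum_congr fun κ => ?_
  simp only [Equiv.ofBijective_apply, e, hext, hcomp]

/-- Normalized sums over partitions converge to integrals over any sorted cell. -/
theorem tendsto_tsum_partition (σ : Equiv.Perm (Fin (d + 1))) {F : (Fin (d + 1) → ℝ) → ℝ}
    (hF : Continuous F) :
    Filter.Tendsto
      (fun n : ℕ => (∑' κ : {k : Fin (d + 1) → ℕ // Antitone k ∧ ∑ i, k i = n},
        F (scaled n κ.1)) / (n : ℝ) ^ d) Filter.atTop
      (nhds (∫ y in sortedCell d σ, F (dsort (extLast (d + 1) y)))) := by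
  have hcont : Continuous fun y : Fin d → ℝ => F (extLast (d + 1) y ∘ σ) :=
    hF.comp (continuous_pi fun i => (continuous_apply (σ i)).comp continuous_extLast)
  have key := tendsto_tsum_div_pow_atTop_integral (sortedCell d σ) _ hcont
    (isCompact_sortedCell σ).isBounded (isCompact_sortedCell σ).measurableSet
    ((convex_sortedCell σ).addHaar_frontier volume)
  have hsort : ∫ y in sortedCell d σ, F (dsort (extLast (d + 1) y)) =
      ∫ y in sortedCell d σ, F (extLast (d + 1) y ∘ σ) :=
    setIntegral_congr_fun (isCompact_sortedCell σ).measurableSet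
      fun y hy => by simp only [dsort_eq_of_antitone hy.2]
  rw [hsort]
  refine key.congr' ?_
  filter_upwards [Filter.eventually_ne_atTop 0] with n hn
  rw [tsum_partition_eq_tsum_lattice σ hn, Fintype.card_fin]

theorem setIntegral_sortedCell_eq (σ τ : Equiv.Perm (Fin (d + 1))) {F : (Fin (d + 1) → ℝ) → ℝ}
    (hF : Continuous F) :
    ∫ y in sortedCell d σ, F (dsort (extLast (d + 1) y)) =
      ∫ y in sortedCell d τ, F (dsort (extLast (d + 1) y)) :=
  tendsto_nhds_unique (tendsto_tsum_partition σ hF) (tendsto_tsum_partition τ hF)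

theorem setIntegral_solidSimplex_dsort {F : (Fin (d + 1) → ℝ) → ℝ} (hF : Continuous F) :
    ∫ y in solidSimplex d, F (dsort (extLast (d + 1) y)) =
      (Fintype.card (Equiv.Perm (Fin (d + 1))) : ℝ) *
        ∫ y in sortedCell d 1, F (dsort (extLast (d + 1) y)) := by
  rw [← iUnion_sortedCell, integral_iUnion_ae
    (fun σ => (isCompact_sortedCell σ).measurableSet.nullMeasurableSet) aedisjoint_sortedCell
    (integrableOn_finite_iUnion.mpr fun σ => integrableOn_sortedCell_dsort σ hF), tsum_fintype,
    Finset.sum_congr rfl fun σ _ => setIntegral_sortedCell_eq σ 1 hF, Finset.sum_const,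
    nsmul_eq_mul, Finset.card_univ]

end RiemannSum

section DirichletIntegral

/-- The integrand of the Gamma function, extended by zero to the negative half-line. -/
noncomputable def gammaIntegrand (α : ℝ) : ℝ → ℝ :=
  (Set.Ici 0).indicator fun x => Real.exp (-x) * x ^ (α - 1)

theorem integrable_gammaIntegrand {α : ℝ} (hα : 0 < α) : Integrable (gammaIntegrand α) := by
  rw [gammaIntegrand, integrable_indicator_iff measurableSet_Ici,
    integrableOn_Ici_iff_integrableOn_Ioi]
  exact Real.GammaIntegral_convergent hα

theorem integral_gammaIntegrand {α : ℝ} (hα : 0 < α) :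
    ∫ x, gammaIntegrand α x = Real.Gamma α := by
  rw [gammaIntegrand, integral_indicator measurableSet_Ici, integral_Ici_eq_integral_Ioi,
    Real.Gamma_eq_integral hα]

theorem gammaIntegrand_of_neg {α x : ℝ} (hx : x < 0) : gammaIntegrand α x = 0 :=
  Set.indicator_of_notMem (by simpa using hx) _

theorem gammaIntegrand_of_nonneg {α x : ℝ} (hx : 0 ≤ x) :
    gammaIntegrand α x = Real.exp (-x) * x ^ (α - 1) :=
  Set.indicator_of_mem (by simpa using hx) _

variable {d : ℕ}

theorem prod_gammaIntegrand_of_neg {α s : ℝ} (hs : s < 0) (y : Fin d → ℝ) :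
    (∏ i, gammaIntegrand α (y i)) * gammaIntegrand α (s - ∑ i, y i) = 0 := by
  by_cases h : ∀ i, 0 ≤ y i
  · rw [gammaIntegrand_of_neg (x := s - _), mul_zero]
    linarith [Finset.sum_nonneg fun i (_ : i ∈ Finset.univ) => h i]
  · push Not at h
    obtain ⟨i, hi⟩ := h
    rw [Finset.prod_eq_zero (Finset.mem_univ i) (gammaIntegrand_of_neg hi), zero_mul]

theorem prod_gammaIntegrand_smul {α s : ℝ} (hs : 0 < s) (y : Fin d → ℝ) :
    (∏ i, gammaIntegrand α ((s • y) i)) * gammaIntegrand α (s - ∑ i, (s • y) i) =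
      Real.exp (-s) * (s ^ (α - 1)) ^ (d + 1) *
        (solidSimplex d).indicator (fun y => ∏ i, extLast (d + 1) y i ^ (α - 1)) y := by
  have hlast : s - ∑ i, (s • y) i = s * extLast (d + 1) y (Fin.last d) := by
    simp only [extLast_last, Pi.smul_apply, smul_eq_mul, ← Finset.mul_sum]
    ring
  have hprod : (∏ i, gammaIntegrand α ((s • y) i)) * gammaIntegrand α (s - ∑ i, (s • y) i) =
      ∏ i, gammaIntegrand α (s * extLast (d + 1) y i) := by
    rw [Fin.prod_univ_castSucc, hlast]
    simp [extLast_castSucc]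
  rw [hprod]
  by_cases hy : y ∈ solidSimplex d
  · rw [Set.indicator_of_mem hy]
    rw [mem_solidSimplex_iff] at hy
    have hexp : Real.exp (-s) = ∏ i, Real.exp (-(s * extLast (d + 1) y i)) := by
      rw [← Real.exp_sum, Finset.sum_neg_distrib, ← Finset.mul_sum, sum_extLast, mul_one]
    have hpow : (s ^ (α - 1)) ^ (d + 1) = ∏ _i : Fin (d + 1), s ^ (α - 1) := by simp
    rw [hexp, hpow, ← Finset.prod_mul_distrib, ← Finset.prod_mul_distrib]
    refine Finset.prod_congr rfl fun i _ => ?_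
    rw [gammaIntegrand_of_nonneg (mul_nonneg hs.le (hy i)), Real.mul_rpow hs.le (hy i), mul_assoc]
  · rw [Set.indicator_of_notMem hy, mul_zero]
    rw [mem_solidSimplex_iff] at hy
    push Not at hy
    obtain ⟨i, hi⟩ := hy
    exact Finset.prod_eq_zero (Finset.mem_univ i)
      (gammaIntegrand_of_neg (mul_neg_of_pos_of_neg hs hi))

theorem measurableSet_solidSimplex : MeasurableSet (solidSimplex d) := by
  rw [← iUnion_sortedCell]
  exact MeasurableSet.iUnion fun σ => (isCompact_sortedCell σ).measurableSet

theorem integral_prod_gammaIntegrand {α s : ℝ} (hs : 0 < s) :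
    ∫ y : Fin d → ℝ, (∏ i, gammaIntegrand α (y i)) * gammaIntegrand α (s - ∑ i, y i) =
      Real.exp (-s) * s ^ (((d + 1 : ℕ) : ℝ) * α - 1) *
        ∫ y in solidSimplex d, ∏ i, extLast (d + 1) y i ^ (α - 1) := by
  have h := Measure.integral_comp_smul (volume : Measure (Fin d → ℝ))
    (fun y => (∏ i, gammaIntegrand α (y i)) * gammaIntegrand α (s - ∑ i, y i)) s
  simp only [prod_gammaIntegrand_smul hs, integral_const_mul,
    integral_indicator measurableSet_solidSimplex, Module.finrank_fin_fun, smul_eq_mul,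
    abs_of_pos (inv_pos.mpr (pow_pos hs d))] at h
  rw [eq_inv_mul_iff_mul_eq₀ (pow_pos hs d).ne'] at h
  rw [← h]
  have hpow : s ^ (((d + 1 : ℕ) : ℝ) * α - 1) = s ^ d * (s ^ (α - 1)) ^ (d + 1) := by
    rw [← Real.rpow_natCast, ← Real.rpow_natCast, ← Real.rpow_mul hs.le, ← Real.rpow_add hs]
    congr 1
    push_cast
    ring
  rw [hpow]
  ring

/-- The Dirichlet integral. -/
theorem gamma_mul_setIntegral_solidSimplex {α : ℝ} (hα : 0 < α) :
    Real.Gamma (((d + 1 : ℕ) : ℝ) * α) *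
      ∫ y in solidSimplex d, ∏ i, extLast (d + 1) y i ^ (α - 1) = Real.Gamma α ^ (d + 1) := by
  have hint := integrable_gammaIntegrand hα
  let H : (Fin d → ℝ) × ℝ → ℝ := fun p => (∏ i, gammaIntegrand α (p.1 i)) * gammaIntegrand α p.2
  have hH : Integrable H (volume.prod volume) :=
    (Integrable.fintype_prod fun _ => hint).mul_prod hint
  have hshear : MeasurePreserving (fun p : (Fin d → ℝ) × ℝ => (p.1, p.2 - ∑ i, p.1 i))
      (volume.prod volume) (volume.prod volume) := by
    refine (MeasurePreserving.id _).skew_product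
      (g := fun (y : Fin d → ℝ) (s : ℝ) => s - ∑ i, y i) ?_ ?_
    · simp only [Function.uncurry_def]
      fun_prop
    · exact Filter.Eventually.of_forall fun y => (measurePreserving_sub_right volume _).map_eq
  have hH' : Integrable (Function.uncurry fun (y : Fin d → ℝ) (s : ℝ) =>
      (∏ i, gammaIntegrand α (y i)) * gammaIntegrand α (s - ∑ i, y i))
      (volume.prod volume) := hshear.integrable_comp_of_integrable hH
  have hswap := integral_integral_swap hH'
  have hleft : ∫ y : Fin d → ℝ, ∫ s : ℝ,
      (∏ i, gammaIntegrand α (y i)) * gammaIntegrand α (s - ∑ i, y i) =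
        Real.Gamma α ^ (d + 1) := by
    simp only [integral_const_mul, integral_sub_right_eq_self (gammaIntegrand α),
      integral_gammaIntegrand hα, integral_mul_const]
    rw [integral_fintype_prod_volume_eq_pow (gammaIntegrand α), integral_gammaIntegrand hα,
      Fintype.card_fin, pow_succ]
  rw [hleft] at hswap
  rw [hswap, ← setIntegral_eq_integral_of_forall_compl_eq_zero (μ := (volume : Measure ℝ))
      (s := Set.Ici 0), integral_Ici_eq_integral_Ioi (μ := (volume : Measure ℝ)),
    setIntegral_congr_fun measurableSet_Ioi fun s hs => integral_prod_gammaIntegrand hs,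
    integral_mul_const, Real.Gamma_eq_integral (by positivity)]
  intro s hs
  simp only [prod_gammaIntegrand_of_neg (not_le.mp hs), integral_zero]

end DirichletIntegral

/-- For fixed `m` and `α > 2` or `α = 1`: if a random partition of `n` into at most `m`
parts is chosen with probability proportional to `∏ (k_i/n)^{α-1}`, then
`(k₁/n,…,k_m/n)` converges weakly to the decreasing order statistics of the symmetric
Dirichlet distribution `Dir(α)`. -/
theorem stmt_12 (m : ℕ) (hm : 2 ≤ m) (α : ℝ) (hα : 2 < α ∨ α = 1) :
    ∀ φ : (Fin m → ℝ) → ℝ, Continuous φ → (∃ C : ℝ, ∀ x, |φ x| ≤ C) →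
      Filter.Tendsto
        (fun n : ℕ =>
          (∑' κ : {k : Fin m → ℕ // Antitone k ∧ ∑ i, k i = n},
              φ (scaled n κ.1) * ∏ i, scaled n κ.1 i ^ (α - 1)) /
          (∑' κ : {k : Fin m → ℕ // Antitone k ∧ ∑ i, k i = n},
              ∏ i, scaled n κ.1 i ^ (α - 1)))
        Filter.atTop
        (nhds (∫ y in {y : Fin (m - 1) → ℝ | (∀ i, 0 ≤ y i) ∧ ∑ i, y i ≤ 1},
          φ (dsort (extLast m y)) *
            (Real.Gamma (m * α) / Real.Gamma α ^ m * ∏ i, extLast m y i ^ (α - 1)))) := by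
  intro φ hφ _
  obtain ⟨d, rfl⟩ : ∃ d, m = d + 1 := ⟨m - 1, by omega⟩
  have hα1 : 0 ≤ α - 1 := by rcases hα with h | h <;> linarith
  have hα0 : 0 < α := by linarith
  let G : (Fin (d + 1) → ℝ) → ℝ := fun x => ∏ i, x i ^ (α - 1)
  have hG : Continuous G := continuous_finsetProd _ fun i _ =>
    (continuous_apply i).rpow_const fun _ => Or.inr hα1
  have hGsort : ∀ x, G (dsort x) = G x := fun x =>
    Equiv.prod_comp (Fin.revPerm.trans (Tuple.sort x)) fun i => x i ^ (α - 1)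
  have hΓ : 0 < Real.Gamma (((d + 1 : ℕ) : ℝ) * α) := Real.Gamma_pos_of_pos (by positivity)
  have hΓ' : 0 < Real.Gamma α := Real.Gamma_pos_of_pos hα0
  have hcard : (Fintype.card (Equiv.Perm (Fin (d + 1))) : ℝ) ≠ 0 :=
    Nat.cast_ne_zero.mpr Fintype.card_ne_zero
  have hnum := setIntegral_solidSimplex_dsort (F := fun x => φ x * G x) (hφ.mul hG)
  have hden := setIntegral_solidSimplex_dsort hG
  have hdir := gamma_mul_setIntegral_solidSimplex (d := d) hα0
  have hden' : ∫ y in solidSimplex d, G (dsort (extLast (d + 1) y)) =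
      Real.Gamma α ^ (d + 1) / Real.Gamma (((d + 1 : ℕ) : ℝ) * α) := by
    rw [eq_div_iff hΓ.ne', ← hdir, mul_comm]
    simp only [hGsort, G]
  have hne : ∫ y in sortedCell d 1, G (dsort (extLast (d + 1) y)) ≠ 0 := by
    intro h
    rw [h, mul_zero, hden'] at hden
    exact (div_pos (pow_pos hΓ' _) hΓ).ne' hden
  have hlim := (tendsto_tsum_partition (d := d) 1 (hφ.mul hG)).div
    (tendsto_tsum_partition 1 hG) hne
  have hval : (∫ y in {y : Fin (d + 1 - 1) → ℝ | (∀ i, 0 ≤ y i) ∧ ∑ i, y i ≤ 1},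
      φ (dsort (extLast (d + 1) y)) *
        (Real.Gamma ((d + 1 : ℕ) * α) / Real.Gamma α ^ (d + 1) *
          ∏ i, extLast (d + 1) y i ^ (α - 1))) =
      (∫ y in sortedCell d 1, φ (dsort (extLast (d + 1) y)) * G (dsort (extLast (d + 1) y))) /
        ∫ y in sortedCell d 1, G (dsort (extLast (d + 1) y)) := by
    have h1 : ∀ y : Fin d → ℝ, φ (dsort (extLast (d + 1) y)) *
        (Real.Gamma ((d + 1 : ℕ) * α) / Real.Gamma α ^ (d + 1) *
          ∏ i, extLast (d + 1) y i ^ (α - 1)) =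
        Real.Gamma ((d + 1 : ℕ) * α) / Real.Gamma α ^ (d + 1) *
          (φ (dsort (extLast (d + 1) y)) * G (dsort (extLast (d + 1) y))) := by
      intro y
      rw [hGsort]
      ring
    change ∫ y in solidSimplex d, _ = _
    simp only [h1]
    rw [integral_const_mul, hnum, eq_div_iff hne]
    rw [hden, eq_div_iff hΓ.ne'] at hden'
    rw [← hden']
    field_simp
  rw [hval]
  refine hlim.congr' ?_
  filter_upwards [Filter.eventually_ne_atTop 0] with n hn
  exact div_div_div_cancel_right₀ (pow_ne_zero d (Nat.cast_ne_zero.mpr hn)) _ _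
end

section
/- For integers n ≥ 1 and m ≥ 2, let ℛ_n(m) = {(k₁,…,k_m) : k₁ > k₂ > … > k_m > 0 integers with k₁ + … + k_m = n} be the set of partitions of n into exactly m distinct parts, and let 𝒫_n(m) be the set of partitions of n into at most m parts. If m = m_n satisfies m = o(n^{1/3}) as n → ∞, then |ℛ_n(m)| / |𝒫_n(m)| ~ exp(−m·(m(m+1)/2)/(n−m)) → 1 as n → ∞; in particular |𝒫_n(m) \ ℛ_n(m)| = o(|𝒫_n(m)|). -/
open scoped BigOperators
open Filter

/-- The set of partitions of `N` into at most `k` parts, encoded as weakly decreasing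
functions `Fin k → ℕ` summing to `N`. -/
def restPart (N k : ℕ) : Set (Fin k → ℕ) := {f | Antitone f ∧ ∑ i, f i = N}

/-- The number of partitions of `N` into at most `k` parts. -/
noncomputable def numPart (N k : ℕ) : ℕ := Nat.card (restPart N k)

/-- The number of partitions of `n` into exactly `m` distinct (strictly decreasing,
positive) parts, `|ℛ_n(m)|`. -/
noncomputable def numDistinctPart (n m : ℕ) : ℕ :=
  Nat.card {f : Fin m → ℕ // StrictAnti f ∧ (∀ i, 0 < f i) ∧ ∑ i, f i = n}

/-- Stars and bars for weak compositions of `N` into `k + 1` parts. -/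
theorem card_weakComposition (N k : ℕ) :
    Nat.card {f : Fin (k + 1) → ℕ // ∑ i, f i = N} = (N + k).choose k := by
  rw [← Nat.card_congr (Sym.equivNatSumOfFintype (Fin (k + 1)) N), Nat.card_eq_fintype_card,
    Sym.card_sym_eq_choose, Fintype.card_fin,
    show k + 1 + N - 1 = N + k by lia, Nat.choose_symm_add]

instance finite_weakComposition (N k : ℕ) : Finite {f : Fin k → ℕ // ∑ i, f i = N} :=
  Finite.of_equiv _ (Sym.equivNatSumOfFintype (Fin k) N)

instance finite_restPart (N k : ℕ) : Finite (restPart N k) :=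
  Finite.of_injective
    (fun f ↦ (⟨f.1, f.2.2⟩ : {f : Fin k → ℕ // ∑ i, f i = N}))
    fun _ _ h ↦ Subtype.ext (Subtype.mk.inj h)

instance finite_distinctPart (n m : ℕ) :
    Finite {f : Fin m → ℕ // StrictAnti f ∧ (∀ i, 0 < f i) ∧ ∑ i, f i = n} :=
  Finite.of_injective
    (fun f ↦ (⟨f.1, f.2.2.2⟩ : {f : Fin m → ℕ // ∑ i, f i = n}))
    fun _ _ h ↦ Subtype.ext (Subtype.mk.inj h)

theorem numDistinctPart_le_numPart (n m : ℕ) : numDistinctPart n m ≤ numPart n m :=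
  Nat.card_le_card_of_injective
    (fun f ↦ (⟨f.1, f.2.1.antitone, f.2.2.2⟩ : restPart n m))
    fun _ _ h ↦ Subtype.ext (Subtype.mk.inj h)

theorem numPart_pos (N k : ℕ) : 0 < numPart N (k + 1) := by
  have : Nonempty (restPart N (k + 1)) := by
    refine ⟨⟨Pi.single 0 N, fun i j hij ↦ ?_, by simp⟩⟩
    rcases eq_or_ne j 0 with rfl | hj
    · rw [Fin.le_zero_iff.1 hij]
    · simp [hj]
  exact Nat.card_pos

theorem Fin.sum_rev_val (k : ℕ) : ∑ i : Fin k, (i.rev : ℕ) = k.choose 2 := by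
  rw [Nat.choose_two_right, ← Finset.sum_range_id, ← Fin.sum_univ_eq_sum_range (fun i ↦ i)]
  exact Equiv.sum_comp Fin.revPerm fun i : Fin k ↦ (i : ℕ)

theorem strictAnti_add_rev {k : ℕ} {f : Fin k → ℕ} (hf : Antitone f) :
    StrictAnti fun i ↦ f i + (i.rev : ℕ) := fun _ _ hij ↦
  add_lt_add_of_le_of_lt (hf hij.le) (Fin.rev_lt_rev.2 hij)

/-- Adding a staircase to a partition with at most `m` parts gives distinct positive parts. -/
theorem numPart_le_numDistinctPart (N m : ℕ) :
    numPart N m ≤ numDistinctPart (N + (m.choose 2 + m)) m := by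
  refine Nat.card_le_card_of_injective
    (fun f : restPart N m ↦ ⟨fun i ↦ f.1 i + (i.rev : ℕ) + 1,
      fun i j hij ↦ Nat.succ_lt_succ (strictAnti_add_rev f.2.1 hij), fun _ ↦ Nat.succ_pos _, ?_⟩) ?_
  · simp only [Finset.sum_add_distrib, Fin.sum_rev_val, f.2.2]
    simp [add_assoc]
  · intro f g h
    ext i
    simpa using congrFun (congrArg Subtype.val h) i

theorem natCard_perm_fin (n : ℕ) : Nat.card (Equiv.Perm (Fin n)) = n.factorial := by
  rw [Nat.card_perm, Nat.card_fin]

/-- Every weak composition is a rearrangement of a partition. -/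
theorem choose_le_factorial_mul_numPart (N k : ℕ) :
    (N + k).choose k ≤ (k + 1).factorial * numPart N (k + 1) := by
  rw [← card_weakComposition, numPart, ← natCard_perm_fin, ← Nat.card_prod]
  refine Nat.card_le_card_of_surjective
    (fun p : Equiv.Perm (Fin (k + 1)) × restPart N (k + 1) ↦
      ⟨p.2.1 ∘ p.1, (Equiv.sum_comp p.1 p.2.1).trans p.2.2.2⟩) fun f ↦ ?_
  let τ := Fin.revPerm.trans (Tuple.sort f.1)
  refine ⟨(τ.symm, ⟨f.1 ∘ τ, fun i j hij ↦ ?_, (Equiv.sum_comp τ f.1).trans f.2⟩), ?_⟩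
  · exact Tuple.monotone_sort f.1 (Fin.rev_le_rev.2 hij)
  · ext i
    simp

/-- The rearrangements of partitions shifted by a staircase are pairwise distinct. -/
theorem factorial_mul_numPart_le_choose (N k : ℕ) :
    (k + 1).factorial * numPart N (k + 1) ≤ (N + (k + 1).choose 2 + k).choose k := by
  rw [← card_weakComposition, numPart, ← natCard_perm_fin, ← Nat.card_prod]
  refine Nat.card_le_card_of_injective
    (fun p : Equiv.Perm (Fin (k + 1)) × restPart N (k + 1) ↦
      ⟨(fun i ↦ p.2.1 i + (i.rev : ℕ)) ∘ p.1, ?_⟩) ?_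
  · refine (Equiv.sum_comp p.1 fun i ↦ p.2.1 i + (i.rev : ℕ)).trans ?_
    rw [Finset.sum_add_distrib, Fin.sum_rev_val, p.2.2.2]
  · rintro ⟨σ, f⟩ ⟨τ, g⟩ h
    replace h := congrArg Subtype.val h
    dsimp only at h
    have hf := strictAnti_add_rev f.2.1
    have hg := strictAnti_add_rev g.2.1
    have key : (fun i ↦ f.1 i + (i.rev : ℕ)) = fun i ↦ g.1 i + (i.rev : ℕ) := by
      have := Tuple.unique_antitone
        (f := (fun i ↦ f.1 i + (i.rev : ℕ)) ∘ σ) (σ := σ.symm) (τ := τ.symm)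
        (by simpa [Function.comp_assoc] using hf.antitone)
        (by rw [h]; simpa [Function.comp_assoc] using hg.antitone)
      nth_rewrite 2 [h] at this
      simpa only [Function.comp_assoc, Equiv.self_comp_symm, Function.comp_id] using this
    rw [key] at h
    refine Prod.ext (Equiv.ext fun i ↦ hg.injective (congrFun h i)) (Subtype.ext (funext fun i ↦ ?_))
    simpa using congrFun key i

theorem Nat.choose_add_le (a d k : ℕ) :
    (a + d).choose (k + 1) ≤ a.choose (k + 1) + d * (a + d - 1).choose k := by
  induction d with
  | zero => simp
  | succ d ih =>
    rw [← add_assoc, Nat.choose_succ_succ', Nat.add_sub_cancel]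
    have := Nat.mul_le_mul_left d (Nat.choose_le_choose k (Nat.sub_le (a + d) 1))
    linarith

/-- The relative loss in `Nat.choose b k` when `b` decreases by `d` is at most `d * k / b`. -/
theorem Nat.add_mul_choose_le (a d k : ℕ) :
    (a + d) * (a + d).choose k ≤ (a + d) * a.choose k + d * k * (a + d).choose k := by
  rcases k with _ | k
  · simp
  rcases hb : a + d with _ | b
  · simp
  have h := Nat.mul_le_mul_left (b + 1) (Nat.choose_add_le a d k)
  rw [hb, Nat.add_sub_cancel] at h
  have := congrArg (d * ·) (Nat.add_one_mul_choose_eq b k)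
  linarith

/-- The proportion of partitions of `n` into at most `m` parts whose parts are not distinct and
positive is at most `m ^ 3 / n`. -/
theorem mul_numPart_le (n k : ℕ) :
    n * numPart n (k + 1) ≤
      n * numDistinctPart n (k + 1) + (k + 1) ^ 3 * numPart n (k + 1) := by
  have hc : (k + 1).choose 2 * 2 = k * (k + 1) := by
    rw [Nat.choose_two_right, Nat.add_sub_cancel,
      Nat.div_mul_cancel (mul_comm k (k + 1) ▸ (Nat.even_mul_succ_self k).two_dvd), mul_comm]
  have hT : (k + 1).choose 2 + (k + 1) ≤ (k + 1) ^ 2 := by nlinarith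
  rcases lt_or_ge n ((k + 1).choose 2 + (k + 1)) with hn | hn
  · have : n ≤ (k + 1) ^ 3 := (hn.le.trans hT).trans (Nat.pow_le_pow_right (by lia) (by lia))
    exact (Nat.mul_le_mul_right _ this).trans (Nat.le_add_left _ _)
  obtain ⟨N, rfl⟩ := Nat.exists_eq_add_of_le' hn
  set c := (k + 1).choose 2
  set n := N + (c + (k + 1))
  set F := (k + 1).factorial
  set P := numPart n (k + 1)
  set R := numDistinctPart n (k + 1)
  have hR : (N + k).choose k ≤ F * R :=
    (choose_le_factorial_mul_numPart N k).trans
      (Nat.mul_le_mul_left _ (numPart_le_numDistinctPart N (k + 1)))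
  have hP : F * P ≤ (n + c + k).choose k := factorial_mul_numPart_le_choose n k
  have hloss := Nat.add_mul_choose_le (N + k) (c + (k + 1) + c) k
  rw [show N + k + (c + (k + 1) + c) = n + c + k by lia] at hloss
  have hd : (c + (k + 1) + c) * k ≤ (k + 1) ^ 3 := by nlinarith
  have hA : (N + k).choose k ≤ (n + c + k).choose k := Nat.choose_le_choose k (by lia)
  set A := (N + k).choose k
  set B := (n + c + k).choose k
  have hB : n * B ≤ n * A + (k + 1) ^ 3 * B := by
    have h1 := Nat.mul_le_mul_left (c + k) hA
    have h2 := Nat.mul_le_mul_right B hd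
    linarith
  rcases lt_or_ge n ((k + 1) ^ 3) with hlt | hge
  · exact (Nat.mul_le_mul_right P hlt.le).trans (Nat.le_add_left _ _)
  obtain ⟨e, he⟩ := Nat.exists_eq_add_of_le hge
  have heB : e * B ≤ n * A := by
    have : n * B = (k + 1) ^ 3 * B + e * B := by rw [he, add_mul]
    lia
  have heP : e * P ≤ n * R := by
    refine Nat.le_of_mul_le_mul_left ?_ (Nat.factorial_pos (k + 1))
    calc F * (e * P) = e * (F * P) := by ring
      _ ≤ e * B := Nat.mul_le_mul_left e hP
      _ ≤ n * A := heB
      _ ≤ n * (F * R) := Nat.mul_le_mul_left n hR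
      _ = F * (n * R) := by ring
  have : n * P = (k + 1) ^ 3 * P + e * P := by rw [he, add_mul]
  lia

/-- If `m = m_n = o(n^{1/3})`, then `|ℛ_n(m)|/|𝒫_n(m)| ~ exp(-m(m(m+1)/2)/(n-m)) → 1`;
in particular `|𝒫_n(m) \ ℛ_n(m)| = o(|𝒫_n(m)|)`. -/
theorem stmt_16 (m : ℕ → ℕ) (hm : ∀ n, 2 ≤ m n)
    (hmo : (fun n => (m n : ℝ)) =o[atTop] fun n => (n : ℝ) ^ ((1 : ℝ) / 3)) :
    Tendsto (fun n : ℕ =>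
        (numDistinctPart n (m n) : ℝ) / (numPart n (m n) : ℝ) /
          Real.exp (-(m n : ℝ) * ((m n : ℝ) * ((m n : ℝ) + 1) / 2) / ((n : ℝ) - (m n : ℝ))))
      atTop (nhds 1) ∧
    Tendsto (fun n : ℕ => (numDistinctPart n (m n) : ℝ) / (numPart n (m n) : ℝ))
      atTop (nhds 1) ∧
    (fun n : ℕ => (numPart n (m n) : ℝ) - (numDistinctPart n (m n) : ℝ)) =o[atTop]
      fun n : ℕ => (numPart n (m n) : ℝ) := by
  have hpos (n) : (0 : ℝ) < numPart n (m n) := by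
    obtain ⟨k, hk⟩ := Nat.exists_eq_add_of_le' (one_le_two.trans (hm n))
    rw [hk]
    exact_mod_cast numPart_pos n k
  have hcube : Tendsto (fun n : ℕ ↦ (m n : ℝ) ^ 3 / n) atTop (nhds 0) := by
    have h := (hmo.pow (n := 3) (by norm_num)).tendsto_div_nhds_zero
    refine h.congr fun n ↦ ?_
    rw [← Real.rpow_natCast ((n : ℝ) ^ ((1 : ℝ) / 3)), ← Real.rpow_mul n.cast_nonneg]
    norm_num
  have hdefect : Tendsto
      (fun n : ℕ ↦ ((numPart n (m n) : ℝ) - numDistinctPart n (m n)) / numPart n (m n))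
      atTop (nhds 0) := by
    refine tendsto_of_tendsto_of_tendsto_of_le_of_le' tendsto_const_nhds hcube
      (Eventually.of_forall fun n ↦ div_nonneg
        (sub_nonneg.2 (by exact_mod_cast numDistinctPart_le_numPart n (m n))) (hpos n).le) ?_
    filter_upwards [eventually_gt_atTop 0] with n hn
    rw [div_le_div_iff₀ (hpos n) (by exact_mod_cast hn)]
    obtain ⟨k, hk⟩ := Nat.exists_eq_add_of_le' (one_le_two.trans (hm n))
    have : (n : ℝ) * numPart n (m n) ≤
        n * numDistinctPart n (m n) + (m n : ℝ) ^ 3 * numPart n (m n) := by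
      rw [hk]
      exact_mod_cast mul_numPart_le n k
    linarith
  have hratio : Tendsto (fun n : ℕ ↦ (numDistinctPart n (m n) : ℝ) / numPart n (m n))
      atTop (nhds 1) := by
    have h := hdefect.const_sub 1
    rw [sub_zero] at h
    refine h.congr fun n ↦ ?_
    rw [sub_div, div_self (hpos n).ne', sub_sub_cancel]
  have hexponent : Tendsto (fun n : ℕ ↦
      (m n : ℝ) * ((m n : ℝ) * ((m n : ℝ) + 1) / 2) / ((n : ℝ) - m n)) atTop (nhds 0) := by
    have h2 := hcube.const_mul 2
    rw [mul_zero] at h2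
    refine squeeze_zero' ?_ ?_ h2
    all_goals
      filter_upwards [eventually_gt_atTop 0, hcube.eventually_lt_const (one_half_pos (α := ℝ))]
        with n hn hlt
      have hn' : (0 : ℝ) < n := by exact_mod_cast hn
      have hm1 : (1 : ℝ) ≤ m n := by exact_mod_cast one_le_two.trans (hm n)
      rw [div_lt_iff₀ hn'] at hlt
      have hle : (m n : ℝ) ≤ (m n : ℝ) ^ 3 := le_self_pow₀ hm1 (by norm_num)
      have hsub : (n : ℝ) / 2 ≤ n - m n := by linarith
    · exact div_nonneg (by positivity) (by linarith)
    · calc _ ≤ (m n : ℝ) ^ 3 / (n / 2) :=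
            div_le_div₀ (by positivity) (by nlinarith [sq_nonneg (m n : ℝ)]) (by positivity) hsub
        _ = _ := by ring
  refine ⟨?_, hratio, (Asymptotics.isLittleO_iff_tendsto fun n h ↦ ((hpos n).ne' h).elim).2 hdefect⟩
  have hexp := (Real.continuous_exp.tendsto _).comp hexponent.neg
  rw [neg_zero, Real.exp_zero] at hexp
  have h := hratio.div hexp one_ne_zero
  rw [div_one] at h
  refine h.congr fun n ↦ ?_
  simp only [Pi.div_apply, Function.comp_apply, neg_mul, neg_div]
end

section
/- Fix an integer m ≥ 2 and q ∈ (0,1). Fix j₀ ∈ {0,1,…,m−1} and consider the subsequence of n with n ≡ j₀ (mod m); define j = j₀ if 1 ≤ j₀ ≤ m−1 and j = m if j₀ = 0. Then as n → ∞ along this subsequence, the partition sum satisfies Σ_{κ = (k₁,…,k_m) ∈ 𝒫_n(m)} q^{k₁} ~ q^{⌈n/m⌉} · Σ_{l=0}^∞ q^{l}·|𝒫_{ml+m−j}(m−1)|, where the series on the right converges. Equivalently, the normalizing constant c of the restricted geometric distribution satisfies c ~ q^{−⌈n/m⌉} / Σ_{l=0}^∞ q^{l}·|𝒫_{ml+m−j}(m−1)|.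 -/
open scoped BigOperators

theorem restPart_le {N k : ℕ} {f : Fin k → ℕ} (hf : f ∈ restPart N k) (i : Fin k) : f i ≤ N :=
  hf.2 ▸ Finset.single_le_sum (f := f) (fun _ _ => Nat.zero_le _) (Finset.mem_univ i)

theorem restPart_subset_pi (N k : ℕ) :
    restPart N k ⊆ ↑(Fintype.piFinset fun _ : Fin k => Finset.range (N + 1)) := by
  intro f hf
  simpa [Nat.lt_succ_iff] using restPart_le hf

instance restPart_finite (N k : ℕ) : Finite (restPart N k) :=
  ((Finset.finite_toSet _).subset (restPart_subset_pi N k)).to_subtype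

theorem numPart_le (N k : ℕ) : numPart N k ≤ (N + 1) ^ k := by
  have h := Set.ncard_le_ncard (restPart_subset_pi N k) (Finset.finite_toSet _)
  rw [Set.ncard_coe_finset, Fintype.card_piFinset_const, Finset.card_range] at h
  exact h

theorem summable_geometric_mul_numPart {q : ℝ} (hq : q ∈ Set.Ioo (0 : ℝ) 1) (a d p : ℕ) :
    Summable fun l : ℕ => q ^ l * (numPart (a * l + d) p : ℝ) := by
  have h₁ : Summable fun l : ℕ => (l : ℝ) ^ p * q ^ l :=
    summable_pow_mul_geometric_of_norm_lt_one p
      (by rw [Real.norm_eq_abs, abs_of_pos hq.1]; exact hq.2)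
  have h₂ := (((summable_nat_add_iff 1).2 h₁).mul_left (((a + d + 1 : ℕ) : ℝ) ^ p * q⁻¹))
  refine Summable.of_nonneg_of_le (fun l => mul_nonneg (pow_nonneg hq.1.le _) (Nat.cast_nonneg _))
    (fun l => ?_) h₂
  have hq0 : q ≠ 0 := hq.1.ne'
  have hle : numPart (a * l + d) p ≤ ((a + d + 1) * (l + 1)) ^ p :=
    (numPart_le _ _).trans (Nat.pow_le_pow_left (by nlinarith) _)
  have hle' : (numPart (a * l + d) p : ℝ) ≤ ((a + d + 1 : ℕ) : ℝ) ^ p * ((l + 1 : ℕ) : ℝ) ^ p := by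
    rw [← mul_pow]; exact_mod_cast hle
  calc q ^ l * (numPart (a * l + d) p : ℝ)
      ≤ q ^ l * (((a + d + 1 : ℕ) : ℝ) ^ p * ((l + 1 : ℕ) : ℝ) ^ p) :=
        mul_le_mul_of_nonneg_left hle' (pow_nonneg hq.1.le _)
    _ = _ := by rw [pow_succ q l]; field_simp

theorem summable_sigma_restPart {q : ℝ} (hq : q ∈ Set.Ioo (0 : ℝ) 1) (a d p : ℕ) :
    Summable fun x : Σ l : ℕ, restPart (a * l + d) p => q ^ x.1 := by
  rw [summable_sigma_of_nonneg fun x => pow_nonneg hq.1.le _]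
  refine ⟨fun l => Summable.of_finite, ?_⟩
  refine (summable_geometric_mul_numPart hq a d p).congr fun l => ?_
  simp only [tsum_const, nsmul_eq_mul, mul_comm (q ^ l)]; rfl

theorem tsum_sigma_restPart {q : ℝ} (hq : q ∈ Set.Ioo (0 : ℝ) 1) (a d p : ℕ) :
    ∑' x : Σ l : ℕ, restPart (a * l + d) p, q ^ x.1
      = ∑' l : ℕ, q ^ l * (numPart (a * l + d) p : ℝ) := by
  rw [(summable_sigma_restPart hq a d p).tsum_sigma]
  refine tsum_congr fun l => ?_
  simp only [tsum_const, nsmul_eq_mul, mul_comm (q ^ l)]; rfl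

/-- The number of parts is `r + 2`; the complement of a partition with largest part `T + l` in the
rectangle with `r + 2` rows of length `T + l`. -/
theorem complement_mem {r n d T l : ℕ} (hn : n + d = (r + 2) * T) {f : Fin (r + 1) → ℕ}
    (hf : f ∈ restPart ((r + 2) * l + d) (r + 1)) (hT : ∀ i, f i ≤ T + l) :
    (Fin.cons (T + l) fun i => T + l - f i.rev : Fin (r + 2) → ℕ) ∈ restPart n (r + 2) := by
  refine ⟨?_, ?_⟩
  · intro i i' hii
    induction i using Fin.cases with
    | zero => induction i' using Fin.cases <;> simp
    | succ i =>
      induction i' using Fin.cases with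
      | zero => simp at hii
      | succ i' =>
        have := hf.1 (Fin.rev_le_rev.2 (Fin.succ_le_succ_iff.1 hii))
        simp only [Fin.cons_succ]
        omega
  · have hsum : ∑ i : Fin (r + 1), (T + l - f i.rev) + ∑ i, f i = (r + 1) * (T + l) := by
      rw [← Equiv.sum_comp Fin.revPerm f, ← Finset.sum_add_distrib]
      simp only [Fin.revPerm_apply]
      rw [Finset.sum_congr rfl fun i _ => Nat.sub_add_cancel (hT i.rev)]
      simp
    rw [hf.2] at hsum
    rw [Fin.sum_cons]
    linarith

theorem exists_complement {r n d T : ℕ} (hn : n + d = (r + 2) * T) (hd : d < r + 2)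
    {k : Fin (r + 2) → ℕ} (hk : k ∈ restPart n (r + 2)) :
    ∃ l, ∃ f ∈ restPart ((r + 2) * l + d) (r + 1), (∀ i, f i ≤ T + l) ∧
      (Fin.cons (T + l) fun i => T + l - f i.rev : Fin (r + 2) → ℕ) = k := by
  have h0 : ∀ i, k i ≤ k 0 := fun i => hk.1 (Fin.zero_le i)
  have hle : n ≤ (r + 2) * k 0 := by
    rw [← hk.2]
    simpa using Finset.sum_le_card_nsmul Finset.univ k (k 0) fun i _ => h0 i
  have hT : T ≤ k 0 := by
    by_contra! h
    have : (r + 2) * (k 0 + 1) ≤ (r + 2) * T := Nat.mul_le_mul_left _ h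
    linarith
  obtain ⟨l, hl⟩ := Nat.exists_eq_add_of_le hT
  refine ⟨l, fun i => k 0 - k i.rev.succ, ⟨?_, ?_⟩, fun i => by simp [hl], ?_⟩
  · intro i i' hii
    have := hk.1 (Fin.succ_le_succ_iff.2 (Fin.rev_le_rev.2 hii))
    exact Nat.sub_le_sub_left this _
  · have hsum : ∑ i : Fin (r + 1), (k 0 - k i.rev.succ) + ∑ i : Fin (r + 1), k i.succ
        = (r + 1) * k 0 := by
      rw [← Equiv.sum_comp Fin.revPerm fun i : Fin (r + 1) => k i.succ, ← Finset.sum_add_distrib]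
      simp only [Fin.revPerm_apply]
      rw [Finset.sum_congr rfl fun i _ => Nat.sub_add_cancel (h0 _)]
      simp
    have hs := hk.2
    rw [Fin.sum_univ_succ] at hs
    nlinarith
  · funext i
    induction i using Fin.cases with
    | zero => simp [hl]
    | succ i =>
      have := h0 i.succ
      simp only [Fin.cons_succ, Fin.rev_rev]
      omega

theorem tsum_largest_part (q : ℝ) {r n d T : ℕ} (hn : n + d = (r + 2) * T) (hd : d < r + 2) :
    ∑' k : restPart n (r + 2), q ^ (k.1 0)
      = q ^ T * ∑' x : Σ l : ℕ, restPart ((r + 2) * l + d) (r + 1),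
          {x : Σ l : ℕ, restPart ((r + 2) * l + d) (r + 1) | ∀ i, x.2.1 i ≤ T + x.1}.indicator
            (fun x => q ^ x.1) x := by
  set B : Set (Σ l : ℕ, restPart ((r + 2) * l + d) (r + 1)) := {x | ∀ i, x.2.1 i ≤ T + x.1}
  rw [← tsum_subtype B, ← tsum_mul_left]
  let g : B → restPart n (r + 2) := fun x =>
    ⟨Fin.cons (T + x.1.1) fun i => T + x.1.1 - x.1.2.1 i.rev, complement_mem hn x.1.2.2 x.2⟩
  have hg : Function.Bijective g := by
    constructor
    · rintro ⟨⟨l, f, hf⟩, hx⟩ ⟨⟨l', f', hf'⟩, hx'⟩ h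
      have h' := @Fin.cons_injective2 (r + 1) (fun _ => ℕ) _ _ _ _ (congrArg Subtype.val h)
      obtain rfl : l = l' := Nat.add_left_cancel h'.1
      obtain rfl : f = f' := by
        funext i
        have h₁ := congrFun h'.2 i.rev
        have h₂ : f i ≤ T + l := hx i
        have h₃ : f' i ≤ T + l := hx' i
        simp only [Fin.rev_rev] at h₁
        omega
      rfl
    · rintro ⟨k, hk⟩
      obtain ⟨l, f, hf, hT, h⟩ := exists_complement hn hd hk
      exact ⟨⟨⟨l, f, hf⟩, hT⟩, Subtype.ext h⟩
  rw [← (Equiv.ofBijective g hg).tsum_eq]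
  refine tsum_congr fun x => ?_
  simp [g, pow_add]

theorem tendsto_tsum_indicator {q : ℝ} (hq : q ∈ Set.Ioo (0 : ℝ) 1) (a d p e : ℕ) :
    Filter.Tendsto (fun t : ℕ => ∑' x : Σ l : ℕ, restPart (a * l + d) p,
        {x : Σ l : ℕ, restPart (a * l + d) p | ∀ i, x.2.1 i ≤ t + e + x.1}.indicator
          (fun x => q ^ x.1) x)
      Filter.atTop (nhds (∑' l : ℕ, q ^ l * (numPart (a * l + d) p : ℝ))) := by
  rw [← tsum_sigma_restPart hq]
  refine tendsto_tsum_of_dominated_convergence (summable_sigma_restPart hq a d p) (fun x => ?_)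
    (Filter.Eventually.of_forall fun t x => ?_)
  · refine tendsto_const_nhds.congr' ?_
    filter_upwards [Filter.eventually_ge_atTop (a * x.1 + d)] with t ht
    rw [Set.indicator_of_mem]
    intro i
    have := restPart_le x.2.2 i
    omega
  · refine (norm_indicator_le_norm_self _ _).trans ?_
    rw [Real.norm_of_nonneg (pow_nonneg hq.1.le _)]

theorem tsum_geometric_mul_numPart_pos {q : ℝ} (hq : q ∈ Set.Ioo (0 : ℝ) 1) (r d : ℕ) :
    0 < ∑' l : ℕ, q ^ l * (numPart ((r + 2) * l + d) (r + 1) : ℝ) := by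
  refine (summable_geometric_mul_numPart hq _ _ _).tsum_pos
    (fun l => mul_nonneg (pow_nonneg hq.1.le _) (Nat.cast_nonneg _)) (r * d)
    (mul_pos (pow_pos hq.1 _) ?_)
  have : Nonempty (restPart ((r + 2) * (r * d) + d) (r + 1)) :=
    ⟨⟨fun _ => (r + 1) * d, antitone_const, by simp; ring⟩⟩
  exact_mod_cast Nat.card_pos

theorem ceil_div_of_add_eq {m n d T : ℕ} (hn : n + d = m * T) (hd : d < m) :
    ⌈((n : ℕ) : ℚ) / (m : ℚ)⌉ = (T : ℤ) := by
  have hm : (0 : ℚ) < m := by exact_mod_cast (Nat.zero_le d).trans_lt hd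
  have hn' : (n : ℚ) + d = m * T := by exact_mod_cast hn
  have hd' : (d : ℚ) < m := by exact_mod_cast hd
  rw [Int.ceil_eq_iff, lt_div_iff₀ hm, div_le_iff₀ hm]
  have : (0 : ℚ) ≤ d := Nat.cast_nonneg d
  push_cast
  constructor <;> nlinarith

/-- Along the subsequence `n = m t + j₀`, the partition sum
`Σ_{κ ∈ 𝒫_n(m)} q^{k₁}` is asymptotic to
`q^{⌈n/m⌉} Σ_{l≥0} q^l |𝒫_{ml+m-j}(m-1)|`, the series being convergent.
Equivalently, the normalizing constant `c` of the restricted geometric distribution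
satisfies `c ~ q^{-⌈n/m⌉}/Σ_{l≥0} q^l |𝒫_{ml+m-j}(m-1)|`. -/
theorem stmt_17 (m : ℕ) (hm : 2 ≤ m) (q : ℝ) (hq : q ∈ Set.Ioo (0 : ℝ) 1)
    (j₀ : ℕ) (hj₀ : j₀ < m) (j : ℕ) (hj : j = if j₀ = 0 then m else j₀) :
    Summable (fun l : ℕ => q ^ l * (numPart (m * l + m - j) (m - 1) : ℝ)) ∧
    Filter.Tendsto (fun t : ℕ =>
        (∑' κ : {k : Fin m → ℕ // Antitone k ∧ ∑ i, k i = m * t + j₀},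
            q ^ (κ.1 ⟨0, by omega⟩)) /
          (q ^ (⌈((m * t + j₀ : ℕ) : ℚ) / (m : ℚ)⌉ : ℤ) *
            ∑' l : ℕ, q ^ l * (numPart (m * l + m - j) (m - 1) : ℝ)))
      Filter.atTop (nhds 1) := by
  obtain ⟨r, rfl⟩ : ∃ r, m = r + 2 := ⟨m - 2, by omega⟩
  obtain ⟨d, e, hd, hjd, hn⟩ : ∃ d e, d < r + 2 ∧ (∀ l, (r + 2) * l + (r + 2) - j
      = (r + 2) * l + d) ∧ ∀ t, (r + 2) * t + j₀ + d = (r + 2) * (t + e) := by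
    refine ⟨r + 2 - j, if j₀ = 0 then 0 else 1, ?_, fun l => ?_, fun t => ?_⟩
    · split_ifs at hj <;> omega
    · split_ifs at hj <;> omega
    · split_ifs at hj ⊢ <;> rw [mul_add] <;> omega
  simp only [hjd, show r + 2 - 1 = r + 1 from rfl]
  refine ⟨summable_geometric_mul_numPart hq _ _ _, ?_⟩
  have hS := tsum_geometric_mul_numPart_pos hq r d
  have hlim := (tendsto_tsum_indicator hq (r + 2) d (r + 1) e).div_const
    (∑' l : ℕ, q ^ l * (numPart ((r + 2) * l + d) (r + 1) : ℝ))
  rw [div_self hS.ne'] at hlim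
  refine hlim.congr fun t => ?_
  rw [ceil_div_of_add_eq (hn t) hd, zpow_natCast]
  have hkey := tsum_largest_part q (hn t) hd
  refine Eq.trans ?_ (congrArg (· / _) hkey.symm)
  exact (mul_div_mul_left _ _ (pow_pos hq.1 _).ne').symm
end

section
/- Let m ≥ 2 and n ≥ 1 be integers, and let G be a bounded Lipschitz function on the closure of the ordered simplex ∇_{m−1} (viewed as a function of (y₁,…,y_{m−1}) via y_m = 1 − Σ_{i=1}^{m−1} y_i). Let ℛ_n(m) = {(k₁,…,k_m) : k₁ > … > k_m > 0 integers summing to n}. Then there exists a constant C₁ depending only on the Lipschitz constant and the supremum norm of G (and not on n or m) such that | n^{−(m−1)} Σ_{(k₁,…,k_m) ∈ ℛ_n(m)} G(k₁/n,…,k_{m−1}/n) − ∫_{∇_{m−1}} G(y₁,…,y_{m−1}) dy₁…dy_{m−1} | ≤ C₁·( √m/n + (1 + m/n)^m / n ). -/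
open scoped BigOperators
open MeasureTheory

/-- The closure of the ordered `(m-1)`-dimensional simplex `∇_{m-1}`. -/
def closedSimplex (m : ℕ) : Set (Fin m → ℝ) :=
  {y | (∀ i, y i ∈ Set.Icc (0 : ℝ) 1) ∧ Antitone y ∧ ∑ i, y i = 1}

/-- The tail sums `i ↦ ∑_{j ≥ i} w j`. -/
def tailSum {R : Type*} [AddCommMonoid R] {d : ℕ} (w : Fin d → R) : Fin d → R :=
  fun i => ∑ j ∈ Finset.Ici i, w j

section TailSum

variable {R : Type*} {d : ℕ}

lemma tailSum_last [AddCommMonoid R] (w : Fin (d + 1) → R) :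
    tailSum w (Fin.last d) = w (Fin.last d) := by
  have : Finset.Ici (Fin.last d) = {Fin.last d} := by
    ext j; simp
  simp [tailSum, this]

lemma tailSum_castSucc [AddCommMonoid R] (w : Fin (d + 1) → R) (i : Fin d) :
    tailSum w i.castSucc = w i.castSucc + tailSum w i.succ := by
  have : Finset.Ici i.castSucc = insert i.castSucc (Finset.Ici i.succ) := by
    ext j
    simp only [Finset.mem_Ici, Finset.mem_insert, Fin.ext_iff, Fin.le_def, Fin.val_castSucc,
      Fin.val_succ]
    omega
  unfold tailSum
  rw [this, Finset.sum_insert]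
  simp [Fin.le_def]

lemma tailSum_zero [AddCommMonoid R] (w : Fin (d + 1) → R) :
    tailSum w 0 = ∑ j, w j := by
  have : Finset.Ici (0 : Fin (d + 1)) = Finset.univ := by
    ext j; simp
  rw [tailSum, this]

lemma sum_tailSum [Semiring R] (w : Fin d → R) :
    ∑ i, tailSum w i = ∑ j : Fin d, ((j : ℕ) + 1 : R) * w j := by
  have h : ∀ i j : Fin d, (i ∈ Finset.univ ∧ j ∈ Finset.Ici i) ↔
      (i ∈ Finset.Iic j ∧ j ∈ Finset.univ) := by simp
  unfold tailSum
  rw [Finset.sum_comm' h]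
  simp

lemma sum_tailSum_add_sum [Semiring R] (w : Fin d → R) :
    ∑ i, tailSum w i + ∑ j, w j = ∑ j : Fin d, ((j : ℕ) + 2 : R) * w j := by
  rw [sum_tailSum, ← Finset.sum_add_distrib]
  refine Finset.sum_congr rfl fun j _ => ?_
  rw [← add_one_mul, add_assoc, one_add_one_eq_two]

lemma tailSum_injective [AddCancelCommMonoid R] :
    Function.Injective (tailSum : (Fin (d + 1) → R) → Fin (d + 1) → R) := by
  intro w v h
  funext i
  induction i using Fin.lastCases with
  | last => rw [← tailSum_last w, ← tailSum_last v, h]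
  | cast i =>
    have h1 := tailSum_castSucc w i
    rw [h, tailSum_castSucc v i] at h1
    exact (add_right_cancel h1).symm

lemma exists_tailSum_eq (u : Fin (d + 1) → ℕ) (hu : StrictAnti u) (hpos : ∀ i, 0 < u i) :
    ∃ k : Fin (d + 1) → ℕ, (∀ i, 0 < k i) ∧ tailSum k = u := by
  refine ⟨Fin.lastCases (u (Fin.last d)) fun i => u i.castSucc - u i.succ, fun i => ?_, ?_⟩
  · induction i using Fin.lastCases with
    | last => simpa using hpos _
    | cast i => simpa using hu i.castSucc_lt_succ
  · funext i
    induction i using Fin.reverseInduction with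
    | last => simp [tailSum_last]
    | cast i ih =>
      rw [tailSum_castSucc, ih, Fin.lastCases_castSucc]
      exact Nat.sub_add_cancel (hu i.castSucc_lt_succ).le

lemma strictAnti_tailSum [AddCommMonoid R] [PartialOrder R] [IsOrderedCancelAddMonoid R]
    (w : Fin (d + 1) → R) (hw : ∀ i, 0 < w i) : StrictAnti (tailSum w) := by
  rw [Fin.strictAnti_iff_succ_lt]
  intro i
  rw [tailSum_castSucc]
  exact lt_add_of_pos_left _ (hw _)

lemma tailSum_pos [AddCommMonoid R] [PartialOrder R] [IsOrderedCancelAddMonoid R]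
    (w : Fin d → R) (hw : ∀ i, 0 < w i) (i : Fin d) : 0 < tailSum w i :=
  Finset.sum_pos (fun j _ => hw j) ⟨i, by simp⟩

end TailSum

/-- The point of the hyperplane `∑ y = 1` whose consecutive differences, apart from the first
one, are given by `w`. -/
noncomputable def gapPoint {d : ℕ} (w : Fin d → ℝ) : Fin (d + 1) → ℝ :=
  Fin.cons (1 - ∑ i, tailSum w i) (tailSum w)

/-- The set of the gap vectors of points of the ordered simplex with positive coordinates. -/
def gapSimplex (d : ℕ) : Set (Fin d → ℝ) :=
  {w | (∀ j, 0 < w j) ∧ ∑ j : Fin d, ((j : ℕ) + 2 : ℝ) * w j < 1}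

/-- The gap vectors of the partitions of `n` into `d + 1` distinct parts. -/
def gapVectors (d n : ℕ) : Finset (Fin d → ℕ) :=
  {k ∈ Fintype.piFinset fun _ => Finset.range n |
    (∀ j, 0 < k j) ∧ ∑ j : Fin d, ((j : ℕ) + 2) * k j < n}

section Gap

variable {d : ℕ}

lemma mem_gapVectors {n : ℕ} {k : Fin d → ℕ} :
    k ∈ gapVectors d n ↔ (∀ j, 0 < k j) ∧ ∑ j : Fin d, ((j : ℕ) + 2) * k j < n := by
  simp only [gapVectors, Finset.mem_filter, Fintype.mem_piFinset, Finset.mem_range,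
    and_iff_right_iff_imp]
  rintro ⟨-, h⟩ j
  have := Finset.single_le_sum (f := fun j : Fin d => ((j : ℕ) + 2) * k j)
    (fun _ _ => Nat.zero_le _) (Finset.mem_univ j)
  nlinarith

lemma sum_gapPoint (w : Fin d → ℝ) : ∑ i, gapPoint w i = 1 := by
  simp [gapPoint, Fin.sum_univ_succ]

lemma strictAnti_cons {α : Type*} [Preorder α] (a : α) (u : Fin (d + 1) → α) :
    StrictAnti (Fin.cons a u : Fin (d + 2) → α) ↔ u 0 < a ∧ StrictAnti u := by
  rw [Fin.strictAnti_iff_succ_lt, Fin.strictAnti_iff_succ_lt, Fin.forall_fin_succ]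
  simp only [Fin.cons_succ, Fin.castSucc_zero, Fin.cons_zero, ← Fin.succ_castSucc]

lemma gapPoint_mem_openSimplex {w : Fin (d + 1) → ℝ} (hw : w ∈ gapSimplex (d + 1)) :
    gapPoint w ∈ openSimplex (d + 2) := by
  obtain ⟨hpos, hsum⟩ := hw
  rw [← sum_tailSum_add_sum, ← tailSum_zero w] at hsum
  have hnn : ∀ i, 0 ≤ gapPoint w i := by
    refine Fin.cases ?_ fun i => ?_
    · have := tailSum_pos w hpos 0
      simp only [gapPoint, Fin.cons_zero]
      linarith
    · exact (tailSum_pos w hpos i).le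
  refine ⟨fun i => ⟨hnn i, ?_⟩, ?_, sum_gapPoint w⟩
  · rw [← sum_gapPoint w]
    exact Finset.single_le_sum (fun j _ => hnn j) (Finset.mem_univ i)
  · exact (strictAnti_cons _ _).2 ⟨by linarith, strictAnti_tailSum w hpos⟩

lemma openSimplex_subset_closedSimplex (m : ℕ) : openSimplex m ⊆ closedSimplex m :=
  fun _ h => ⟨h.1, h.2.1.antitone, h.2.2⟩

lemma mem_gapSimplex_of_gapPoint_mem {w : Fin (d + 1) → ℝ}
    (hw : gapPoint w ∈ openSimplex (d + 2)) (hlast : w (Fin.last d) ≠ 0) :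
    w ∈ gapSimplex (d + 1) := by
  obtain ⟨h01, hanti, -⟩ := hw
  obtain ⟨h0, hanti⟩ := (strictAnti_cons _ _).1 hanti
  refine ⟨fun i => ?_, ?_⟩
  · induction i using Fin.lastCases with
    | last =>
      refine lt_of_le_of_ne ?_ hlast.symm
      have := (h01 (Fin.last d).succ).1
      rwa [gapPoint, Fin.cons_succ, tailSum_last] at this
    | cast i =>
      have := hanti i.castSucc_lt_succ
      rw [tailSum_castSucc] at this
      linarith
  · rw [← sum_tailSum_add_sum, ← tailSum_zero w]
    linarith

lemma extLast_init_gapPoint (w : Fin (d + 1) → ℝ) :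
    extLast (d + 2) (Fin.init (gapPoint w)) = gapPoint w := by
  funext i
  have h := sum_gapPoint w
  rw [Fin.sum_univ_castSucc] at h
  induction i using Fin.lastCases with
  | last =>
    simp only [extLast]
    rw [dif_neg (by simp)]
    change 1 - ∑ k : Fin (d + 1), gapPoint w k.castSucc = _
    linarith
  | cast i =>
    simp only [extLast]
    rw [dif_pos (by simp; omega)]
    rfl

lemma continuous_tailSum : Continuous (tailSum : (Fin d → ℝ) → Fin d → ℝ) :=
  continuous_pi fun i => by unfold tailSum; fun_prop

lemma continuous_gapPoint : Continuous (gapPoint : (Fin d → ℝ) → Fin (d + 1) → ℝ) := by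
  refine continuous_pi (Fin.cases ?_ fun i => ?_)
  · simp only [gapPoint, Fin.cons_zero]
    exact continuous_const.sub
      (continuous_finsetSum _ fun i _ => (continuous_apply i).comp continuous_tailSum)
  · exact (continuous_apply i).comp continuous_tailSum

lemma gapPoint_injective :
    Function.Injective (gapPoint : (Fin (d + 1) → ℝ) → Fin (d + 2) → ℝ) :=
  fun _ _ h => tailSum_injective (Fin.cons_inj.1 h).2

lemma isOpen_gapSimplex : IsOpen (gapSimplex d) := by
  refine IsOpen.and ?_ (isOpen_lt
    (continuous_finsetSum _ fun j _ => continuous_const.mul (continuous_apply j)) continuous_const)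
  simp only [Set.ofPred_forall]
  exact isOpen_iInter_of_finite fun j => isOpen_lt continuous_const (continuous_apply j)

end Gap

section Measure

lemma measurePreserving_tailSum (d : ℕ) :
    MeasurePreserving (tailSum : (Fin d → ℝ) → Fin d → ℝ) := by
  let M : Matrix (Fin d) (Fin d) ℝ := Matrix.of fun i j => if i ≤ j then 1 else 0
  have hM : (tailSum : (Fin d → ℝ) → Fin d → ℝ) = Matrix.toLin' M := by
    funext w i
    simp [M, tailSum, Matrix.mulVec, dotProduct, ← Finset.sum_filter, Finset.filter_le_eq_Ici]
  have hdet : M.det = 1 := by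
    rw [Matrix.det_of_isUpperTriangular]
    · simp [M]
    · intro i j hij
      simp only [M, Matrix.of_apply]
      exact if_neg (not_le.2 hij)
  refine ⟨continuous_tailSum.measurable, ?_⟩
  rw [hM, Real.map_matrix_volume_pi_eq_smul_volume_pi (by simp [hdet]), hdet]
  simp

lemma measurePreserving_mul_add {c : ℝ} (hc : |c| = 1) (b : ℝ) :
    MeasurePreserving fun x : ℝ => c * x + b := by
  have hc0 : c ≠ 0 := by
    rintro rfl
    simp at hc
  have h : MeasurePreserving fun x : ℝ => c * x :=
    ⟨measurable_const_mul c, by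
      rw [Real.map_volume_mul_left hc0, abs_inv, hc]
      simp⟩
  exact (measurePreserving_add_right volume b).comp h

/-- Replacing the coordinate `u i` by `± u i` plus a function of the other coordinates, and
moving it to the position `j`, preserves the volume. -/
lemma measurePreserving_insertNth_removeNth {e : ℕ} (i j : Fin (e + 1)) {c : ℝ} (hc : |c| = 1)
    {f : (Fin e → ℝ) → ℝ} (hf : Measurable f) :
    MeasurePreserving fun u : Fin (e + 1) → ℝ =>
      (j.insertNth (c * u i + f (i.removeNth u)) (i.removeNth u) : Fin (e + 1) → ℝ) := by
  have h1 := volume_preserving_piFinSuccAbove (fun _ : Fin (e + 1) => ℝ) i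
  have h2 := (volume_preserving_piFinSuccAbove (fun _ : Fin (e + 1) => ℝ) j).symm
  have h3 : MeasurePreserving
      (fun p : (Fin e → ℝ) × ℝ => ((p.1, c * p.2 + f p.1) : (Fin e → ℝ) × ℝ)) :=
    (MeasurePreserving.id (volume : Measure (Fin e → ℝ))).skew_product
      (g := fun v t => c * t + f v)
      (by simp only [Function.uncurry_def]; fun_prop)
      (Filter.Eventually.of_forall fun v => (measurePreserving_mul_add hc (f v)).map_eq)
  exact h2.comp (Measure.measurePreserving_swap.comp
    (h3.comp (Measure.measurePreserving_swap.comp h1)))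

lemma measurePreserving_init_gapPoint (e : ℕ) :
    MeasurePreserving fun w : Fin (e + 1) → ℝ => (Fin.init (gapPoint w) : Fin (e + 1) → ℝ) := by
  have h := (measurePreserving_insertNth_removeNth (Fin.last e) 0 (c := -1) (by simp)
    (f := fun v => 1 - ∑ i, v i) (by fun_prop)).comp (measurePreserving_tailSum (e + 1))
  convert h using 2 with w
  funext i
  simp only [Function.comp, gapPoint, Fin.insertNth_zero', Fin.removeNth_last]
  refine Fin.cases ?_ (fun i => ?_) i
  · simp only [Fin.init, Fin.castSucc_zero, Fin.cons_zero]
    rw [Fin.sum_univ_castSucc]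
    ring
  · simp only [Fin.init, ← Fin.succ_castSucc, Fin.cons_succ]

lemma prod_inv_add_two (d : ℕ) : ∏ j : Fin d, (((j : ℕ) : ℝ) + 2)⁻¹ =
    ((d + 1).factorial : ℝ)⁻¹ := by
  induction d with
  | zero => simp
  | succ d ih =>
    rw [Fin.prod_univ_castSucc]
    simp only [Fin.val_castSucc, Fin.val_last]
    rw [ih, Nat.factorial_succ (d + 1)]
    push_cast
    rw [mul_inv, mul_comm]
    ring_nf

variable {d : ℕ}

lemma le_inv_of_sum_le {w : Fin d → ℝ} (h0 : ∀ j, 0 ≤ w j)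
    (h : ∑ j : Fin d, ((j : ℕ) + 2 : ℝ) * w j ≤ 1) (j : Fin d) : w j ≤ (((j : ℕ) : ℝ) + 2)⁻¹ := by
  have h1 := Finset.single_le_sum (f := fun j : Fin d => ((j : ℕ) + 2 : ℝ) * w j)
    (fun j _ => mul_nonneg (by positivity) (h0 j)) (Finset.mem_univ j)
  rw [← one_div, le_div_iff₀' (by positivity)]
  exact h1.trans h

lemma gapSimplex_subset_Icc :
    gapSimplex d ⊆ Set.Icc 0 fun j : Fin d => (((j : ℕ) : ℝ) + 2)⁻¹ :=
  fun _ hw => ⟨fun j => (hw.1 j).le, le_inv_of_sum_le (fun j => (hw.1 j).le) hw.2.le⟩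

lemma volume_gapSimplex_ne_top : volume (gapSimplex d) ≠ ⊤ :=
  measure_ne_top_of_subset gapSimplex_subset_Icc isCompact_Icc.measure_lt_top.ne

lemma volume_real_gapSimplex_le :
    volume.real (gapSimplex d) ≤ ((d + 1).factorial : ℝ)⁻¹ := by
  refine (measureReal_mono gapSimplex_subset_Icc isCompact_Icc.measure_lt_top.ne).trans_eq ?_
  rw [measureReal_def, Real.volume_Icc_pi_toReal fun j => by simp only [Pi.zero_apply]; positivity]
  simp only [Pi.zero_apply, sub_zero]
  exact prod_inv_add_two d

/-- The part of the simplex of gap vectors close to its outer face has small volume. -/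
lemma volume_real_shell_le {r : ℝ} (hr : 0 ≤ r) {e : ℕ} {S : Set (Fin (e + 1) → ℝ)}
    (hS : S ⊆ gapSimplex (e + 1))
    (hSr : ∀ w ∈ S, 1 - r ≤ ∑ j : Fin (e + 1), ((j : ℕ) + 2 : ℝ) * w j) :
    volume.real S ≤ r * ((e + 2).factorial : ℝ)⁻¹ := by
  let f : (Fin e → ℝ) → ℝ := fun v => ∑ j : Fin e, (((j : ℕ) : ℝ) + 3) / 2 * v j
  have hφ := measurePreserving_insertNth_removeNth (0 : Fin (e + 1)) 0 (c := 1) (by simp)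
    (f := f) (by fun_prop)
  let a : Fin (e + 1) → ℝ := Fin.cons ((1 - r) / 2) 0
  let b : Fin (e + 1) → ℝ := Fin.cons (1 / 2) fun j : Fin e => (((j : ℕ) : ℝ) + 3)⁻¹
  have hsub : S ⊆ (fun u : Fin (e + 1) → ℝ => (Fin.insertNth 0 (1 * u 0 + f (Fin.removeNth 0 u))
      (Fin.removeNth 0 u) : Fin (e + 1) → ℝ)) ⁻¹' Set.Icc a b := by
    intro w hw
    have h1 := hSr w hw
    obtain ⟨h0, h2⟩ := hS hw
    have h3 := le_inv_of_sum_le (fun j => (h0 j).le) h2.le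
    have hsum : ∑ j : Fin (e + 1), ((j : ℕ) + 2 : ℝ) * w j =
        2 * (1 * w 0 + f (Fin.removeNth 0 w)) := by
      simp only [Fin.sum_univ_succ, f, Fin.removeNth_zero, Fin.tail, mul_add, Finset.mul_sum,
        Fin.val_zero, Fin.val_succ]
      congr 1
      · simp
      · refine Finset.sum_congr rfl fun j _ => ?_
        push_cast
        ring
    rw [hsum] at h1 h2
    refine ⟨fun i => ?_, fun i => ?_⟩ <;> refine Fin.cases ?_ (fun j => ?_) i
    · simp only [Fin.insertNth_zero', Fin.cons_zero, a]
      linarith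
    · simpa [a, Fin.removeNth_zero, Fin.tail] using (h0 j.succ).le
    · simp only [Fin.insertNth_zero', Fin.cons_zero, b]
      linarith
    · have := h3 j.succ
      simp only [Fin.val_succ] at this
      push_cast at this
      simp only [Fin.insertNth_zero', Fin.cons_succ, b, Fin.removeNth_zero, Fin.tail]
      refine this.trans_eq ?_
      congr 1
      ring
  have hvol : (volume (Set.Icc a b)).toReal = r * ((e + 2).factorial : ℝ)⁻¹ := by
    rw [Real.volume_Icc_pi_toReal]
    · rw [← prod_inv_add_two, Fin.prod_univ_succ, Fin.prod_univ_succ]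
      simp only [a, b, Fin.cons_zero, Fin.cons_succ, Pi.zero_apply, sub_zero, Fin.val_zero,
        Fin.val_succ]
      rw [← mul_assoc]
      congr 1
      · push_cast
        ring
      · refine Finset.prod_congr rfl fun j _ => ?_
        push_cast
        congr 1
        ring
    · refine Fin.cases ?_ fun j => ?_
      · simp only [a, b, Fin.cons_zero]
        linarith
      · simp only [a, b, Fin.cons_succ, Pi.zero_apply]
        positivity
  rw [← hvol, ← hφ.measure_preimage measurableSet_Icc.nullMeasurableSet]
  refine measureReal_mono hsub ?_
  rw [hφ.measure_preimage measurableSet_Icc.nullMeasurableSet]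
  exact isCompact_Icc.measure_lt_top.ne

/-- The integral over `D` is close to a Riemann sum over equally large disjoint cells in `D`. -/
lemma abs_mul_sum_sub_setIntegral_le {α ι : Type*} [MeasurableSpace α] {μ : Measure α}
    {D : Set α} (hDfin : μ D ≠ ⊤) {F : α → ℝ} (hF : IntegrableOn F D μ)
    {B : ℝ} (hB : ∀ x ∈ D, |F x| ≤ B) (s : Finset ι) {C : ι → Set α}
    (hC : ∀ k ∈ s, MeasurableSet (C k)) (hCD : ∀ k ∈ s, C k ⊆ D)
    (hdisj : (s : Set ι).PairwiseDisjoint C) {v ε δ : ℝ} (hv : ∀ k ∈ s, μ.real (C k) = v)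
    (hε : 0 ≤ ε) (hB0 : 0 ≤ B)
    (g : ι → ℝ) (hg : ∀ k ∈ s, ∀ x ∈ C k, |g k - F x| ≤ ε)
    (hδ : μ.real (D \ ⋃ k ∈ s, C k) ≤ δ) :
    |v * ∑ k ∈ s, g k - ∫ x in D, F x ∂μ| ≤ ε * μ.real D + B * δ := by
  have hUD : ⋃ k ∈ s, C k ⊆ D := Set.iUnion₂_subset hCD
  have hU : MeasurableSet (⋃ k ∈ s, C k) := s.measurableSet_biUnion hC
  have hfin : ∀ {A : Set α}, A ⊆ D → μ A ≠ ⊤ := fun hA => measure_ne_top_of_subset hA hDfin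
  have hsplit : ∫ x in D, F x ∂μ =
      ∑ k ∈ s, ∫ x in C k, F x ∂μ + ∫ x in D \ ⋃ k ∈ s, C k, F x ∂μ := by
    rw [← integral_biUnion_finset s hC hdisj fun k hk => hF.mono_set (hCD k hk),
      setIntegral_sdiff hU hF hUD]
    ring
  have hvol : ∑ k ∈ s, μ.real (C k) ≤ μ.real D := by
    rw [← measureReal_biUnion_finset hdisj hC fun k hk => hfin (hCD k hk)]
    exact measureReal_mono hUD hDfin
  have hcell : ∀ k ∈ s, |v * g k - ∫ x in C k, F x ∂μ| ≤ ε * μ.real (C k) := by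
    intro k hk
    have h1 : v * g k - ∫ x in C k, F x ∂μ = ∫ x in C k, (g k - F x) ∂μ := by
      rw [integral_sub (integrableOn_const (hfin (hCD k hk)) enorm_ne_top).integrable
        (hF.mono_set (hCD k hk)),
        setIntegral_const, hv k hk, smul_eq_mul]
    rw [h1, ← Real.norm_eq_abs]
    exact norm_setIntegral_le_of_norm_le_const (hfin (hCD k hk)).lt_top (hg k hk)
  have hrest : |∫ x in D \ ⋃ k ∈ s, C k, F x ∂μ| ≤ B * δ := by
    rw [← Real.norm_eq_abs]
    exact (norm_setIntegral_le_of_norm_le_const (hfin Set.sdiff_subset).lt_top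
      fun x hx => hB x hx.1).trans (mul_le_mul_of_nonneg_left hδ hB0)
  have hsum : |∑ k ∈ s, (v * g k - ∫ x in C k, F x ∂μ)| ≤ ε * μ.real D :=
    (Finset.abs_sum_le_sum_abs _ _).trans ((Finset.sum_le_sum hcell).trans (by
      rw [← Finset.mul_sum]
      exact mul_le_mul_of_nonneg_left hvol hε))
  rw [hsplit, Finset.mul_sum, ← sub_sub, ← Finset.sum_sub_distrib]
  exact (abs_sub _ _).trans (add_le_add hsum hrest)

end Measure

section RiemannSum

variable {d n : ℕ}

/-- The cube of side `1 / n` with upper corner `k / n`. -/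
def gapCell (n : ℕ) {d : ℕ} (k : Fin d → ℕ) : Set (Fin d → ℝ) :=
  Set.univ.pi fun j => Set.Ioc (((k j : ℝ) - 1) / n) (k j / n)

lemma measurableSet_gapCell (k : Fin d → ℕ) : MeasurableSet (gapCell n k) :=
  MeasurableSet.univ_pi fun _ => measurableSet_Ioc

lemma volume_real_gapCell (k : Fin d → ℕ) :
    volume.real (gapCell n k) = ((n : ℝ) ^ d)⁻¹ := by
  rw [measureReal_def, gapCell, Real.volume_pi_Ioc_toReal fun j => by
    gcongr
    linarith]
  simp [← sub_div]

lemma mem_gapCell_iff (hn : 0 < n) {k : Fin d → ℕ} (hk : ∀ j, 0 < k j) {w : Fin d → ℝ} :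
    w ∈ gapCell n k ↔ ∀ j, ⌈w j * n⌉₊ = k j := by
  have hn' : (0 : ℝ) < n := by exact_mod_cast hn
  simp only [gapCell, Set.mem_univ_pi, Set.mem_Ioc]
  refine forall_congr' fun j => ?_
  rw [Nat.ceil_eq_iff (hk j).ne', div_lt_iff₀ hn', le_div_iff₀ hn', Nat.cast_pred (hk j)]

lemma pairwiseDisjoint_gapCell (hn : 0 < n) :
    (gapVectors d n : Set (Fin d → ℕ)).PairwiseDisjoint (gapCell n) := by
  intro k hk l hl hkl
  refine Set.disjoint_left.2 fun w hw hw' => hkl (funext fun j => ?_)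
  rw [← (mem_gapCell_iff hn (mem_gapVectors.1 hk).1).1 hw j,
    (mem_gapCell_iff hn (mem_gapVectors.1 hl).1).1 hw' j]

lemma div_mem_gapSimplex (hn : 0 < n) {k : Fin d → ℕ} (hk : k ∈ gapVectors d n) :
    (fun j => (k j : ℝ) / n) ∈ gapSimplex d := by
  have hn' : (0 : ℝ) < n := by exact_mod_cast hn
  obtain ⟨hpos, hsum⟩ := mem_gapVectors.1 hk
  refine ⟨fun j => div_pos (by exact_mod_cast hpos j) hn', ?_⟩
  simp only [← mul_div_assoc]
  rw [← Finset.sum_div, div_lt_one hn']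
  exact_mod_cast hsum

lemma gapCell_subset_gapSimplex (hn : 0 < n) {k : Fin d → ℕ} (hk : k ∈ gapVectors d n) :
    gapCell n k ⊆ gapSimplex d := by
  intro w hw
  have hn' : (0 : ℝ) < n := by exact_mod_cast hn
  refine ⟨fun j => ?_, ?_⟩
  · have h1 : (1 : ℝ) ≤ k j := by exact_mod_cast (mem_gapVectors.1 hk).1 j
    exact (div_nonneg (by linarith) hn'.le).trans_lt (hw j trivial).1
  · refine lt_of_le_of_lt (Finset.sum_le_sum fun j _ => ?_) (div_mem_gapSimplex hn hk).2
    exact mul_le_mul_of_nonneg_left (hw j trivial).2 (by positivity)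

/-- The points of the simplex lying in none of the cells are close to its outer face. -/
lemma le_sum_of_notMem_gapCell (hn : 0 < n) {w : Fin d → ℝ} (hw : w ∈ gapSimplex d)
    (hw' : w ∉ ⋃ k ∈ gapVectors d n, gapCell n k) :
    1 - (d * (d + 1) : ℝ) / n ≤ ∑ j : Fin d, ((j : ℕ) + 2 : ℝ) * w j := by
  have hn' : (0 : ℝ) < n := by exact_mod_cast hn
  let k : Fin d → ℕ := fun j => ⌈w j * n⌉₊
  have hkpos : ∀ j, 0 < k j := fun j => Nat.ceil_pos.2 (mul_pos (hw.1 j) hn')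
  have hwk : w ∈ gapCell n k := (mem_gapCell_iff hn hkpos).2 fun _ => rfl
  have hk : n ≤ ∑ j : Fin d, ((j : ℕ) + 2) * k j := by
    by_contra! h
    exact hw' (Set.mem_iUnion₂.2 ⟨k, mem_gapVectors.2 ⟨hkpos, h⟩, hwk⟩)
  have hterm : ∀ j : Fin d,
      ((j : ℕ) + 2 : ℝ) * k j ≤ n * (((j : ℕ) + 2 : ℝ) * w j) + (d + 1) := by
    intro j
    have h1 : (k j : ℝ) < w j * n + 1 := Nat.ceil_lt_add_one (mul_pos (hw.1 j) hn').le
    have h2 : ((j : ℕ) : ℝ) + 1 ≤ d := by exact_mod_cast j.2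
    have h3 : (0 : ℝ) ≤ ((j : ℕ) : ℝ) + 2 := by positivity
    nlinarith
  have h : (n : ℝ) ≤ n * ∑ j : Fin d, ((j : ℕ) + 2 : ℝ) * w j + d * (d + 1) := by
    calc (n : ℝ) ≤ ∑ j : Fin d, ((j : ℕ) + 2 : ℝ) * k j := by exact_mod_cast hk
      _ ≤ ∑ j : Fin d, (n * (((j : ℕ) + 2 : ℝ) * w j) + (d + 1)) :=
        Finset.sum_le_sum fun j _ => hterm j
      _ = _ := by simp [Finset.sum_add_distrib, Finset.mul_sum, mul_add]
  rw [tsub_le_iff_right, ← sub_le_iff_le_add', le_div_iff₀ hn']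
  linarith

lemma sqrt_sum_sq_gapPoint_sub_le {η : ℝ} {w v : Fin d → ℝ} (h : ∀ j, |w j - v j| ≤ η) :
    √(∑ i, (gapPoint w i - gapPoint v i) ^ 2) ≤ 2 * (d * (d * η)) := by
  have htail : ∀ i, |tailSum w i - tailSum v i| ≤ d * η := by
    intro i
    have hη : 0 ≤ η := (abs_nonneg _).trans (h i)
    unfold tailSum
    rw [← Finset.sum_sub_distrib]
    calc |∑ j ∈ Finset.Ici i, (w j - v j)| ≤ ∑ j ∈ Finset.Ici i, |w j - v j| :=
          Finset.abs_sum_le_sum_abs _ _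
      _ ≤ ∑ j : Fin d, |w j - v j| :=
          Finset.sum_le_sum_of_subset_of_nonneg (Finset.subset_univ _) fun _ _ _ => abs_nonneg _
      _ ≤ ∑ j : Fin d, η := Finset.sum_le_sum fun j _ => h j
      _ = d * η := by simp
  have hsum : ∑ i, |tailSum w i - tailSum v i| ≤ d * (d * η) :=
    (Finset.sum_le_sum fun i _ => htail i).trans_eq (by simp)
  have hfirst : |(1 - ∑ i, tailSum w i) - (1 - ∑ i, tailSum v i)| ≤ d * (d * η) := by
    rw [sub_sub_sub_cancel_left, abs_sub_comm, ← Finset.sum_sub_distrib]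
    exact (Finset.abs_sum_le_sum_abs _ _).trans hsum
  have habs : ∑ i, |gapPoint w i - gapPoint v i| ≤ 2 * (d * (d * η)) := by
    rw [Fin.sum_univ_succ]
    simp only [gapPoint, Fin.cons_zero, Fin.cons_succ]
    linarith
  refine le_trans (Real.sqrt_le_iff.2 ⟨Finset.sum_nonneg fun i _ => abs_nonneg _, ?_⟩) habs
  simp only [← sq_abs (gapPoint w _ - gapPoint v _)]
  exact Finset.sum_sq_le_sq_sum_of_nonneg fun i _ => abs_nonneg _

lemma scaled_cons_tailSum (hn : 0 < n) (k : Fin d → ℕ) (h : ∑ i, tailSum k i ≤ n) :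
    scaled n (Fin.cons (n - ∑ i, tailSum k i) (tailSum k) : Fin (d + 1) → ℕ) =
      gapPoint fun j => (k j : ℝ) / n := by
  have hn' : (n : ℝ) ≠ 0 := by exact_mod_cast hn.ne'
  have htail : ∀ i, tailSum (fun j => (k j : ℝ) / n) i = (tailSum k i : ℕ) / n := by
    intro i
    simp [tailSum, Finset.sum_div]
  funext i
  refine Fin.cases ?_ (fun i => ?_) i
  · simp only [scaled, gapPoint, Fin.cons_zero, htail]
    rw [Nat.cast_sub h, ← Finset.sum_div, sub_div, div_self hn', Nat.cast_sum]
  · simp only [scaled, gapPoint, Fin.cons_succ, htail]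

lemma tsum_partitions_eq_sum_gapVectors {e : ℕ} (hn : 0 < n) (G : (Fin (e + 2) → ℝ) → ℝ) :
    ∑' κ : {k : Fin (e + 2) → ℕ // StrictAnti k ∧ (∀ i, 0 < k i) ∧ ∑ i, k i = n},
      G (scaled n κ.1) = ∑ k ∈ gapVectors (e + 1) n, G (gapPoint fun j => (k j : ℝ) / n) := by
  have hlt : ∀ k : gapVectors (e + 1) n, ∑ i, tailSum k.1 i + tailSum k.1 0 < n := by
    intro k
    rw [tailSum_zero k.1, sum_tailSum_add_sum]
    exact (mem_gapVectors.1 k.2).2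
  let φ : gapVectors (e + 1) n →
      {k : Fin (e + 2) → ℕ // StrictAnti k ∧ (∀ i, 0 < k i) ∧ ∑ i, k i = n} := fun k =>
    ⟨Fin.cons (n - ∑ i, tailSum k.1 i) (tailSum k.1), by
      have h := hlt k
      have hpos := (mem_gapVectors.1 k.2).1
      refine ⟨(strictAnti_cons _ _).2 ⟨by omega, strictAnti_tailSum _ hpos⟩, ?_, ?_⟩
      · refine Fin.cases ?_ fun i => ?_
        · rw [Fin.cons_zero]
          omega
        · exact tailSum_pos _ hpos i
      · rw [Fin.sum_univ_succ]
        simp only [Fin.cons_zero, Fin.cons_succ]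
        omega⟩
  have hφ : Function.Bijective φ := by
    constructor
    · intro k l hkl
      have h : (φ k).1 = (φ l).1 := congrArg Subtype.val hkl
      exact Subtype.ext (tailSum_injective (funext fun i => congrFun h i.succ))
    · rintro ⟨κ, hanti, hpos, hsum⟩
      rw [← Fin.cons_self_tail κ, strictAnti_cons] at hanti
      obtain ⟨k, hk, hkκ⟩ := exists_tailSum_eq (Fin.tail κ) hanti.2 fun i => hpos _
      have hsum' : κ 0 + ∑ i, Fin.tail κ i = n := by
        rw [← hsum, Fin.sum_univ_succ κ]
        rfl
      refine ⟨⟨k, mem_gapVectors.2 ⟨hk, ?_⟩⟩, Subtype.ext ?_⟩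
      · have := sum_tailSum_add_sum k
        rw [← tailSum_zero k, hkκ] at this
        have h0 := hanti.1
        simp only [Nat.cast_id] at this
        omega
      · simp only [φ, hkκ]
        conv_rhs => rw [← Fin.cons_self_tail κ]
        congr 1
        omega
  rw [← Finset.tsum_subtype, ← (Equiv.ofBijective φ hφ).tsum_eq]
  refine tsum_congr fun k => congrArg G (scaled_cons_tailSum hn k.1 ?_)
  have := hlt k
  omega

lemma setIntegral_openSimplex_eq {e : ℕ} (G : (Fin (e + 2) → ℝ) → ℝ) :
    ∫ y in {y : Fin (e + 1) → ℝ | extLast (e + 2) y ∈ openSimplex (e + 2)},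
      G (extLast (e + 2) y) = ∫ w in gapSimplex (e + 1), G (gapPoint w) := by
  have hcont : Continuous fun w : Fin (e + 1) → ℝ => (Fin.init (gapPoint w) : Fin (e + 1) → ℝ) :=
    continuous_pi fun i => (continuous_apply i.castSucc).comp continuous_gapPoint
  have hinj : Function.Injective
      fun w : Fin (e + 1) → ℝ => (Fin.init (gapPoint w) : Fin (e + 1) → ℝ) := by
    intro w v h
    apply gapPoint_injective
    rw [← extLast_init_gapPoint w, ← extLast_init_gapPoint v]
    exact congrArg (extLast (e + 2)) h
  rw [← (measurePreserving_init_gapPoint e).setIntegral_preimage_emb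
    (hcont.measurableEmbedding hinj)]
  simp only [Set.preimage_ofPred_eq, extLast_init_gapPoint]
  refine setIntegral_congr_set ?_
  have hnull : ∀ᵐ w : Fin (e + 1) → ℝ, w (Fin.last e) ≠ 0 :=
    Measure.ae_eval_ne (fun _ : Fin (e + 1) => (volume : Measure ℝ)) (Fin.last e) 0
  filter_upwards [hnull] with w hw
  exact propext ⟨fun h => mem_gapSimplex_of_gapPoint_mem h hw, gapPoint_mem_openSimplex⟩

lemma continuousOn_of_abs_sub_le {m : ℕ} {S : Set (Fin m → ℝ)} {G : (Fin m → ℝ) → ℝ} {L : ℝ}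
    (hG : ∀ x ∈ S, ∀ z ∈ S, |G x - G z| ≤ L * √(∑ i, (x i - z i) ^ 2)) : ContinuousOn G S := by
  intro z hz
  refine tendsto_iff_dist_tendsto_zero.2 ?_
  have hlim : Filter.Tendsto (fun x : Fin m → ℝ => L * √(∑ i, (x i - z i) ^ 2))
      (nhdsWithin z S) (nhds 0) := by
    have : Continuous fun x : Fin m → ℝ => L * √(∑ i, (x i - z i) ^ 2) := by fun_prop
    simpa using (this.tendsto z).mono_left nhdsWithin_le_nhds
  refine squeeze_zero' (Filter.Eventually.of_forall fun _ => dist_nonneg) ?_ hlim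
  filter_upwards [self_mem_nhdsWithin] with x hx
  exact hG x hx z hz

end RiemannSum

/-- Riemann-sum approximation over partitions with distinct parts: for a bounded
Lipschitz function `G` on the closure of `∇_{m-1}` (with Lipschitz constant `L` and
bound `B`), there is a constant `C₁` depending only on `L` and `B` such that
`|n^{-(m-1)} Σ_{ℛ_n(m)} G(κ/n) - ∫_{∇_{m-1}} G| ≤ C₁(√m/n + (1+m/n)^m/n)`. -/
theorem stmt_18 (L B : ℝ) :
    ∃ C₁ : ℝ, ∀ m n : ℕ, 2 ≤ m → 1 ≤ n → ∀ G : (Fin m → ℝ) → ℝ,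
      (∀ x ∈ closedSimplex m, |G x| ≤ B) →
      (∀ x ∈ closedSimplex m, ∀ z ∈ closedSimplex m,
        |G x - G z| ≤ L * Real.sqrt (∑ i, (x i - z i) ^ 2)) →
      |((n : ℝ) ^ (m - 1))⁻¹ *
          (∑' κ : {k : Fin m → ℕ // StrictAnti k ∧ (∀ i, 0 < k i) ∧ ∑ i, k i = n},
            G (scaled n κ.1)) -
        ∫ y in {y : Fin (m - 1) → ℝ | extLast m y ∈ openSimplex m}, G (extLast m y)|
      ≤ C₁ * (Real.sqrt m / n + (1 + (m : ℝ) / n) ^ m / n) := by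
  refine ⟨2 * |L| + |B|, fun m n hm hn G hGB hGL => ?_⟩
  obtain ⟨e, rfl⟩ : ∃ e, m = e + 2 := ⟨m - 2, by omega⟩
  have hn' : (0 : ℝ) < n := by exact_mod_cast hn
  have hmem : ∀ {w : Fin (e + 1) → ℝ}, w ∈ gapSimplex (e + 1) →
      gapPoint w ∈ closedSimplex (e + 2) := fun hw =>
    openSimplex_subset_closedSimplex _ (gapPoint_mem_openSimplex hw)
  have hbound : ∀ w ∈ gapSimplex (e + 1), |G (gapPoint w)| ≤ |B| := fun w hw =>
    (hGB _ (hmem hw)).trans (le_abs_self B)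
  have hmeas : MeasurableSet (gapSimplex (e + 1)) := isOpen_gapSimplex.measurableSet
  have hint : IntegrableOn (fun w => G (gapPoint w)) (gapSimplex (e + 1)) :=
    IntegrableOn.of_bound volume_gapSimplex_ne_top.lt_top
      (((continuousOn_of_abs_sub_le hGL).comp continuous_gapPoint.continuousOn
        fun _ => hmem).aestronglyMeasurable hmeas) |B|
      ((ae_restrict_iff' hmeas).2 (Filter.Eventually.of_forall hbound))
  set d : ℕ := e + 1
  set ε : ℝ := |L| * (2 * (d * (d * (1 / n)))) with hε
  set r : ℝ := (d * (d + 1) : ℝ) / n with hr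
  have hcell : ∀ k ∈ gapVectors d n, ∀ w ∈ gapCell n k,
      |G (gapPoint fun j => (k j : ℝ) / n) - G (gapPoint w)| ≤ ε := by
    intro k hk w hw
    refine (hGL _ (hmem (div_mem_gapSimplex hn hk)) _
      (hmem (gapCell_subset_gapSimplex hn hk hw))).trans ?_
    refine mul_le_mul (le_abs_self L) (sqrt_sum_sq_gapPoint_sub_le fun j => ?_)
      (Real.sqrt_nonneg _) (abs_nonneg L)
    obtain ⟨h1, h2⟩ := hw j trivial
    rw [sub_div] at h1
    rw [abs_le]
    constructor <;> linarith
  have hshell : volume.real (gapSimplex d \ ⋃ k ∈ gapVectors d n, gapCell n k) ≤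
      r * ((e + 2).factorial : ℝ)⁻¹ :=
    volume_real_shell_le (by positivity) Set.sdiff_subset fun w hw =>
      le_sum_of_notMem_gapCell hn hw.1 hw.2
  have hmain := abs_mul_sum_sub_setIntegral_le volume_gapSimplex_ne_top hint hbound
    (gapVectors d n) (fun k _ => measurableSet_gapCell k)
    (fun k hk => gapCell_subset_gapSimplex hn hk) (pairwiseDisjoint_gapCell hn)
    (fun k _ => volume_real_gapCell k) (by positivity) (abs_nonneg B)
    (fun k => G (gapPoint fun j => (k j : ℝ) / n)) hcell hshell
  have hfact : (d * (d + 1) : ℝ) * ((e + 2).factorial : ℝ)⁻¹ ≤ 1 := by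
    rw [mul_inv_le_iff₀ (by positivity), one_mul]
    have h1 : d ≤ (e + 1).factorial := Nat.self_le_factorial _
    have h2 : d * (d + 1) ≤ (e + 2).factorial := by
      rw [Nat.factorial_succ, mul_comm]
      exact Nat.mul_le_mul_left _ h1
    exact_mod_cast h2
  have hvol := volume_real_gapSimplex_le (d := d)
  have hone : (1 : ℝ) / n ≤ √((e + 2 : ℕ) : ℝ) / n +
      (1 + ((e + 2 : ℕ) : ℝ) / n) ^ (e + 2) / n := by
    have h1 : (1 : ℝ) ≤ √((e + 2 : ℕ) : ℝ) := Real.one_le_sqrt.2 (by push_cast; linarith)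
    have h2 : (1 : ℝ) / n ≤ √((e + 2 : ℕ) : ℝ) / n := by gcongr
    exact h2.trans (le_add_of_nonneg_right (by positivity))
  rw [tsum_partitions_eq_sum_gapVectors hn]
  refine le_trans ?_ (mul_le_mul_of_nonneg_left hone (by positivity))
  refine le_trans (le_of_eq_of_le ?_ hmain) ?_
  · congr 2
    exact setIntegral_openSimplex_eq G
  · have hε0 : ε * volume.real (gapSimplex d) ≤ 2 * |L| * (1 / n) := by
      calc ε * volume.real (gapSimplex d)
          ≤ (2 * |L| * (1 / n) * (d * (d + 1))) * ((e + 2).factorial : ℝ)⁻¹ := by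
            refine mul_le_mul ?_ hvol measureReal_nonneg (by positivity)
            have h0 : (0 : ℝ) ≤ 2 * |L| * (1 / n) * d := by positivity
            rw [hε]
            linarith
        _ = 2 * |L| * (1 / n) * ((d * (d + 1)) * ((e + 2).factorial : ℝ)⁻¹) := by ring
        _ ≤ 2 * |L| * (1 / n) * 1 := by gcongr
        _ = _ := mul_one _
    have hδ0 : |B| * (r * ((e + 2).factorial : ℝ)⁻¹) ≤ |B| * (1 / n) := by
      refine mul_le_mul_of_nonneg_left ?_ (abs_nonneg B)
      calc r * ((e + 2).factorial : ℝ)⁻¹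
          = (d * (d + 1) * ((e + 2).factorial : ℝ)⁻¹) * (1 / n) := by rw [hr]; ring
        _ ≤ 1 * (1 / n) := by gcongr
        _ = _ := one_mul _
    linarith
end

section
/- Fix q ∈ (0,1), set λ = −log q, and let γ = (1/λ²)·∫₀^λ s/(e^s − 1) ds and t₀ = γ^{−1/2} = λ/(∫₀^λ s/(e^s − 1) ds)^{1/2}. Let m = m_n → ∞ with m = o(n^{1/3}), let j = m + n − m⌈n/m⌉ ∈ {1,…,m}, and let M_n = ⌊(1/(m−1))(n/m − m)⌋. Then as n → ∞, Σ_{l=1}^{M_n + 1} q^{l}·|𝒫_{lm−j}(m−1)| ~ (f(t₀)/t₀)·e^{λ t₀^{−2} − ψ(t₀) − λ j/m}·√(8π/|ψ″(t₀)|)·e^{m ψ(t₀)} / m^{3/2}, where for u > 0, v(u) is the unique positive solution of u² = v²/∫₀^v s/(e^s − 1) ds, f(u) = (v/(2^{3/2} π u))·(1 − e^{−v} − (1/2)u² e^{−v})^{−1/2}, g(u) = 2v/u − u·log(1 − e^{−v}), and ψ(t) = g(t)/t − λ/t². -/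
open scoped BigOperators
open Filter

/-- An antitone function on `Fin (k + 1)` is its last value together with the antitone function
obtained by subtracting this value from the others. -/
def antitoneSnocEquiv (k : ℕ) :
    {f : Fin (k + 1) → ℕ // Antitone f} ≃ ℕ × {f : Fin k → ℕ // Antitone f} where
  toFun f := (f.1 (Fin.last k), ⟨fun i => f.1 i.castSucc - f.1 (Fin.last k),
    fun _ _ h => Nat.sub_le_sub_right (f.2 (Fin.castSucc_le_castSucc_iff.2 h)) _⟩)
  invFun p := ⟨Fin.snoc (α := fun _ => ℕ) (fun i => p.2.1 i + p.1) p.1, by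
    intro a b h
    induction b using Fin.lastCases with
    | last =>
      induction a using Fin.lastCases with
      | last => exact le_rfl
      | cast a => simp
    | cast b =>
      induction a using Fin.lastCases with
      | last => exact absurd h (not_le.2 (Fin.castSucc_lt_last b))
      | cast a => simpa using p.2.2 (Fin.castSucc_le_castSucc_iff.1 h)⟩
  left_inv f := by
    ext i
    induction i using Fin.lastCases with
    | last => simp
    | cast i => simp [Nat.sub_add_cancel (f.2 (Fin.le_last i.castSucc))]
  right_inv p := by
    ext <;> simp

lemma sum_antitoneSnocEquiv_symm (k : ℕ) (p : ℕ × {f : Fin k → ℕ // Antitone f}) :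
    ∑ i, ((antitoneSnocEquiv k).symm p).1 i = (k + 1) * p.1 + ∑ i, p.2.1 i := by
  simp only [antitoneSnocEquiv, Equiv.coe_fn_symm_mk, Fin.sum_univ_castSucc, Fin.snoc_castSucc,
    Fin.snoc_last, Finset.sum_add_distrib, Finset.sum_const, Finset.card_univ, Fintype.card_fin,
    smul_eq_mul]
  ring

lemma summable_antitone_pow (k : ℕ) {x : ℝ} (hx0 : 0 ≤ x) (hx : x < 1) :
    Summable fun f : {f : Fin k → ℕ // Antitone f} => x ^ ∑ i, f.1 i := by
  induction k with
  | zero => exact Summable.of_finite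
  | succ k ih =>
    rw [← (antitoneSnocEquiv k).symm.summable_iff]
    have hgeo : Summable fun c : ℕ => (x ^ (k + 1)) ^ c :=
      summable_geometric_of_lt_one (by positivity) (pow_lt_one₀ hx0 hx (by omega))
    refine (hgeo.mul_of_nonneg ih (fun _ => by positivity) (fun _ => by positivity)).congr
      fun p => ?_
    simp only [Function.comp_apply, sum_antitoneSnocEquiv_symm, pow_add, pow_mul]

lemma hasSum_antitone_pow (k : ℕ) {z : ℂ} (hz : ‖z‖ < 1) :
    HasSum (fun f : {f : Fin k → ℕ // Antitone f} => z ^ ∑ i, f.1 i)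
      (∏ i ∈ Finset.range k, (1 - z ^ (i + 1))⁻¹) := by
  induction k with
  | zero =>
    have : Unique {f : Fin 0 → ℕ // Antitone f} :=
      ⟨⟨⟨fun i => i.elim0, fun i => i.elim0⟩⟩, fun f => Subtype.ext (Subsingleton.elim _ _)⟩
    simp
  | succ k ih =>
    rw [← (antitoneSnocEquiv k).symm.hasSum_iff, Finset.prod_range_succ, mul_comm]
    have hz' : ‖z ^ (k + 1)‖ < 1 := by
      rw [norm_pow]; exact pow_lt_one₀ (norm_nonneg _) hz (by omega)
    have hs := summable_mul_of_summable_norm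
      (f := fun c : ℕ => (z ^ (k + 1)) ^ c)
      (g := fun f : {f : Fin k → ℕ // Antitone f} => z ^ ∑ i, f.1 i)
      (by simpa only [norm_pow] using summable_geometric_of_lt_one (norm_nonneg _) hz')
      (by simpa only [norm_pow] using summable_antitone_pow k (norm_nonneg z) hz)
    refine ((hasSum_geometric_of_norm_lt_one hz').mul ih hs).congr_fun fun p => ?_
    simp only [Function.comp_apply, sum_antitoneSnocEquiv_symm, pow_add, pow_mul]

lemma finite_restPart_s19 (N k : ℕ) : (restPart N k).Finite := by
  refine (Set.Finite.pi' fun _ : Fin k => Set.finite_Iic N).subset ?_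
  rintro f ⟨-, hf⟩ i
  exact (Finset.single_le_sum (fun _ _ => Nat.zero_le _) (Finset.mem_univ i)).trans hf.le

/-- The generating function of partitions into at most `k` parts. -/
lemma hasSum_numPart_mul_pow (k : ℕ) {z : ℂ} (hz : ‖z‖ < 1) :
    HasSum (fun N : ℕ => (numPart N k : ℂ) * z ^ N)
      (∏ i ∈ Finset.range k, (1 - z ^ (i + 1))⁻¹) := by
  have h := hasSum_antitone_pow k hz
  rw [← (Equiv.sigmaFiberEquiv
    fun f : {f : Fin k → ℕ // Antitone f} => ∑ i, f.1 i).hasSum_iff] at h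
  refine h.sigma fun N => ?_
  let e : {f : {f : Fin k → ℕ // Antitone f} // ∑ i, f.1 i = N} ≃ restPart N k :=
    Equiv.subtypeSubtypeEquivSubtypeInter (fun f : Fin k → ℕ => Antitone f)
      (fun f => ∑ i, f i = N)
  have : Fintype (restPart N k) := (finite_restPart_s19 N k).fintype
  have : Fintype {f : {f : Fin k → ℕ // Antitone f} // ∑ i, f.1 i = N} :=
    Fintype.ofEquiv _ e.symm
  have h2 := hasSum_fintype fun c : {f : {f : Fin k → ℕ // Antitone f} // ∑ i, f.1 i = N} =>
    z ^ (∑ i, c.1.1 i)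
  have hc : ∀ c : {f : {f : Fin k → ℕ // Antitone f} // ∑ i, f.1 i = N},
      z ^ (∑ i, c.1.1 i) = z ^ N := fun c => by rw [c.2]
  have hcard : Fintype.card {f : {f : Fin k → ℕ // Antitone f} // ∑ i, f.1 i = N} =
      numPart N k := by
    rw [numPart, ← Nat.card_congr e, Nat.card_eq_fintype_card]
  rw [Finset.sum_congr rfl fun c _ => hc c, Finset.sum_const, nsmul_eq_mul, Finset.card_univ,
    hcard] at h2
  exact h2

lemma hasSum_numPart_mul_pow_real (k : ℕ) {x : ℝ} (hx0 : 0 ≤ x) (hx : x < 1) :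
    HasSum (fun N : ℕ => (numPart N k : ℝ) * x ^ N)
      (∏ i ∈ Finset.range k, (1 - x ^ (i + 1))⁻¹) := by
  have := hasSum_numPart_mul_pow k (z := (x : ℂ)) (by simpa [abs_of_nonneg hx0] using hx)
  exact_mod_cast this

lemma add_one_mul_sub_injective {m j : ℕ} (hm : 0 < m) (hjm : j ≤ m) :
    Function.Injective fun l : ℕ => (l + 1) * m - j := by
  intro l l' h
  have h1 : m ≤ (l + 1) * m := Nat.le_mul_of_pos_left _ (by omega)
  have h2 : m ≤ (l' + 1) * m := Nat.le_mul_of_pos_left _ (by omega)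
  have h3 : (l + 1) * m = (l' + 1) * m := by simp only at h; omega
  have := Nat.eq_of_mul_eq_mul_right (by omega) h3
  omega

/-- Extraction of an arithmetic progression from a series by roots of unity. -/
lemma hasSum_arith_progression {m j : ℕ} (hj1 : 1 ≤ j) (hjm : j ≤ m) {a : ℕ → ℝ}
    {ζ : ℂ} (hζ : IsPrimitiveRoot ζ m) {G : ℕ → ℂ}
    (hG : ∀ r ∈ Finset.range m, HasSum (fun N => (a N : ℂ) * (ζ ^ r) ^ N) (G r)) :
    HasSum (fun l : ℕ => (a ((l + 1) * m - j) : ℂ))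
      ((m : ℂ)⁻¹ * ∑ r ∈ Finset.range m, (ζ ^ r) ^ j * G r) := by
  have hm0 : m ≠ 0 := by omega
  have hsum := (hasSum_sum fun r hr => (hG r hr).mul_left ((ζ ^ r) ^ j)).mul_left (m : ℂ)⁻¹
  have key : ∀ N, (m : ℂ)⁻¹ * ∑ r ∈ Finset.range m, (ζ ^ r) ^ j * ((a N : ℂ) * (ζ ^ r) ^ N) =
      if m ∣ N + j then (a N : ℂ) else 0 := by
    intro N
    have : ∀ r, (ζ ^ r) ^ j * ((a N : ℂ) * (ζ ^ r) ^ N) = a N * (ζ ^ (N + j)) ^ r := by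
      intro r; ring
    simp only [this, ← Finset.mul_sum]
    split_ifs with h
    · rw [(hζ.pow_eq_one_iff_dvd _).2 h]
      have : (m : ℂ) ≠ 0 := Nat.cast_ne_zero.2 hm0
      simp; field_simp
    · have h1 : ζ ^ (N + j) ≠ 1 := fun h' => h ((hζ.pow_eq_one_iff_dvd _).1 h')
      rw [geom_sum_eq h1, ← pow_mul, mul_comm (N + j), pow_mul, hζ.pow_eq_one]
      simp
  simp only [key] at hsum
  have hinj := add_one_mul_sub_injective (Nat.pos_of_ne_zero hm0) hjm
  have hN : ∀ l : ℕ, (l + 1) * m - j + j = (l + 1) * m := fun l =>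
    Nat.sub_add_cancel (hjm.trans (Nat.le_mul_of_pos_left _ (by omega)))
  rw [← hinj.hasSum_iff] at hsum
  · refine hsum.congr_fun fun l => ?_
    simp [hN]
  · intro N hN'
    refine if_neg fun ⟨c, hc⟩ => hN' ⟨c - 1, ?_⟩
    have hc0 : c ≠ 0 := by rintro rfl; omega
    simp only [Nat.sub_add_cancel (Nat.one_le_iff_ne_zero.2 hc0), mul_comm c, ← hc]
    omega

lemma sum_one_sub_re_pow {m r : ℕ} (hr : r ∈ Finset.Ico 1 m) {ζ : ℂ} (hζ : IsPrimitiveRoot ζ m) :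
    ∑ i ∈ Finset.range (m - 1), (1 - ((ζ ^ r) ^ (i + 1)).re) / 2 = (m : ℝ) / 2 := by
  obtain ⟨hr1, hrm⟩ := Finset.mem_Ico.1 hr
  have h1 : ζ ^ r ≠ 1 := hζ.pow_ne_one_of_pos_of_lt (by omega) hrm
  have h0 : ∑ i ∈ Finset.range m, (ζ ^ r) ^ i = 0 := by
    rw [geom_sum_eq h1, ← pow_mul, mul_comm, pow_mul, hζ.pow_eq_one]; simp
  have h2 : ∑ i ∈ Finset.range m, (1 - ((ζ ^ r) ^ i).re) / 2 = (m : ℝ) / 2 := by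
    rw [← Finset.sum_div, Finset.sum_sub_distrib, ← Complex.re_sum, h0]; simp
  obtain ⟨k, rfl⟩ : ∃ k, m = k + 1 := ⟨m - 1, by omega⟩
  rw [Finset.sum_range_succ'] at h2
  simpa using h2

/-- Away from the trivial root of unity the generating product is exponentially smaller. -/
lemma norm_prod_inv_le {m r : ℕ} {q x : ℝ} (hr : r ∈ Finset.Ico 1 m) {ζ : ℂ}
    (hζ : IsPrimitiveRoot ζ m) (hq : 0 < q) (hx0 : 0 < x) (hx : x < 1) (hxm : x ^ m = q) :
    ‖∏ i ∈ Finset.range (m - 1), (1 - ((x : ℂ) * ζ ^ r) ^ (i + 1))⁻¹‖ ≤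
      (∏ i ∈ Finset.range (m - 1), (1 - x ^ (i + 1))⁻¹) * (1 + 4 * q) ^ (-((m : ℝ) / 4)) := by
  have hm0 : m ≠ 0 := by have := Finset.mem_Ico.1 hr; omega
  have hfac : ∀ i ∈ Finset.range (m - 1), ‖(1 - ((x : ℂ) * ζ ^ r) ^ (i + 1))⁻¹‖ ≤
      (1 - x ^ (i + 1))⁻¹ * (1 + 4 * q) ^ (-((1 - ((ζ ^ r) ^ (i + 1)).re) / 2 / 2)) := by
    intro i hi
    have him : i + 1 ≤ m := by have := Finset.mem_range.1 hi; omega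
    set w := (ζ ^ r) ^ (i + 1)
    set X := x ^ (i + 1)
    have hX0 : 0 < X := by positivity
    have hX1 : X < 1 := pow_lt_one₀ hx0.le hx (by omega)
    have hqX : q ≤ X := hxm ▸ pow_le_pow_of_le_one hx0.le hx.le him
    have hw : ‖w‖ = 1 := by simp [w, norm_pow, hζ.norm'_eq_one hm0]
    have hw2 : w.re ^ 2 + w.im ^ 2 = 1 := by
      have := Complex.sq_norm w
      rw [hw, Complex.normSq_apply] at this; nlinarith
    have hre : |w.re| ≤ 1 := hw ▸ Complex.abs_re_le_norm w
    obtain ⟨hre1, hre2⟩ := abs_le.1 hre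
    set y := (1 - w.re) / 2 with hy
    have hy0 : 0 ≤ y := by simp only [hy]; linarith
    have hy1 : y ≤ 1 := by simp only [hy]; linarith
    have hb : (1 + 4 * q) ^ y ≤ 1 + y * (4 * q) :=
      rpow_one_add_le_one_add_mul_self (by linarith) hy0 hy1
    have hn : ‖1 - ((x : ℂ) * ζ ^ r) ^ (i + 1)‖ ^ 2 = (1 - X) ^ 2 + 4 * X * y := by
      have : ((x : ℂ) * ζ ^ r) ^ (i + 1) = (X : ℂ) * w := by simp [X, w, mul_pow]
      rw [this, Complex.sq_norm, Complex.normSq_apply]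
      simp only [Complex.sub_re, Complex.one_re, Complex.mul_re, Complex.ofReal_re,
        Complex.ofReal_im, Complex.sub_im, Complex.one_im, Complex.mul_im, hy]
      linear_combination X ^ 2 * hw2
    have hsq : ((1 - X) * (1 + 4 * q) ^ (y / 2)) ^ 2 ≤ ‖1 - ((x : ℂ) * ζ ^ r) ^ (i + 1)‖ ^ 2 := by
      rw [hn, mul_pow, ← Real.rpow_natCast ((1 + 4 * q) ^ (y / 2)), ← Real.rpow_mul (by linarith)]
      have : y / 2 * (2 : ℕ) = y := by push_cast; ring
      rw [this]
      have h1 : (1 - X) ^ 2 ≤ 1 := by nlinarith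
      calc (1 - X) ^ 2 * (1 + 4 * q) ^ y ≤ (1 - X) ^ 2 * (1 + y * (4 * q)) := by gcongr
        _ = (1 - X) ^ 2 + (1 - X) ^ 2 * (4 * q * y) := by ring
        _ ≤ (1 - X) ^ 2 + 1 * (4 * X * y) := by gcongr
        _ = _ := by ring
    have hle := le_of_sq_le_sq hsq (norm_nonneg _)
    have hpos : 0 < (1 - X) * (1 + 4 * q) ^ (y / 2) :=
      mul_pos (by linarith) (Real.rpow_pos_of_pos (by linarith) _)
    rw [norm_inv, Real.rpow_neg (by linarith), ← mul_inv]
    exact inv_anti₀ hpos hle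
  rw [norm_prod]
  refine (Finset.prod_le_prod (fun _ _ => norm_nonneg _) hfac).trans_eq ?_
  rw [Finset.prod_mul_distrib, ← Real.rpow_sum_of_pos (by linarith)]
  congr 2
  rw [Finset.sum_neg_distrib, ← Finset.sum_div, sum_one_sub_re_pow hr hζ]
  ring

lemma prod_inv_pos {x : ℝ} (hx0 : 0 < x) (hx : x < 1) (k : ℕ) :
    0 < ∏ i ∈ Finset.range k, (1 - x ^ (i + 1))⁻¹ :=
  Finset.prod_pos fun i _ => inv_pos.2 (sub_pos.2 (pow_lt_one₀ hx0.le hx (by omega)))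

/-- The generating series of partitions along a residue class is asymptotically evenly
distributed among the classes. -/
lemma abs_tsum_arith_progression_sub_le {m j : ℕ} (hm : 2 ≤ m) (hj1 : 1 ≤ j) (hjm : j ≤ m)
    {q x : ℝ} (hq : 0 < q) (hx0 : 0 < x) (hx : x < 1) (hxm : x ^ m = q) :
    |∑' l : ℕ, (numPart ((l + 1) * m - j) (m - 1) : ℝ) * x ^ ((l + 1) * m - j) -
        (∏ i ∈ Finset.range (m - 1), (1 - x ^ (i + 1))⁻¹) / m| ≤
      (∏ i ∈ Finset.range (m - 1), (1 - x ^ (i + 1))⁻¹) * (1 + 4 * q) ^ (-((m : ℝ) / 4)) := by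
  set P := ∏ i ∈ Finset.range (m - 1), (1 - x ^ (i + 1))⁻¹ with hP
  set ζ := Complex.exp (2 * Real.pi * Complex.I / m)
  have hm0 : m ≠ 0 := by omega
  have hζ : IsPrimitiveRoot ζ m := Complex.isPrimitiveRoot_exp m hm0
  set G : ℕ → ℂ := fun r => ∏ i ∈ Finset.range (m - 1), (1 - ((x : ℂ) * ζ ^ r) ^ (i + 1))⁻¹
    with hGdef
  set a : ℕ → ℝ := fun N => (numPart N (m - 1) : ℝ) * x ^ N with ha
  have hG : ∀ r ∈ Finset.range m, HasSum (fun N => (a N : ℂ) * (ζ ^ r) ^ N) (G r) := by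
    intro r _
    have hn : ‖(x : ℂ) * ζ ^ r‖ < 1 := by
      simpa [hζ.norm'_eq_one hm0, abs_of_pos hx0] using hx
    refine (hasSum_numPart_mul_pow (m - 1) hn).congr_fun fun N => ?_
    simp [ha, mul_pow, mul_assoc]
  have hc := hasSum_arith_progression hj1 hjm hζ hG
  have hS : ((∑' l : ℕ, a ((l + 1) * m - j) : ℝ) : ℂ) =
      (m : ℂ)⁻¹ * ∑ r ∈ Finset.range m, (ζ ^ r) ^ j * G r := by
    rw [Complex.ofReal_tsum]; exact hc.tsum_eq
  have hG0 : G 0 = (P : ℂ) := by simp [hGdef, hP]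
  have hsplit : ((∑' l : ℕ, a ((l + 1) * m - j) - P / m : ℝ) : ℂ) =
      (m : ℂ)⁻¹ * ∑ r ∈ Finset.Ico 1 m, (ζ ^ r) ^ j * G r := by
    rw [Complex.ofReal_sub, hS, Finset.range_eq_Ico,
      Finset.sum_eq_sum_Ico_succ_bot (by omega : 0 < m), hG0]
    push_cast
    simp
    ring
  have hPpos := prod_inv_pos hx0 hx (m - 1)
  rw [← hP] at hPpos
  have hE : 0 < (1 + 4 * q) ^ (-((m : ℝ) / 4)) := Real.rpow_pos_of_pos (by linarith) _
  have hmpos : (0 : ℝ) < m := by positivity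
  calc |∑' l : ℕ, a ((l + 1) * m - j) - P / m|
      = ‖(m : ℂ)⁻¹ * ∑ r ∈ Finset.Ico 1 m, (ζ ^ r) ^ j * G r‖ := by
        rw [← hsplit, Complex.norm_real, Real.norm_eq_abs]
    _ ≤ (m : ℝ)⁻¹ * ∑ r ∈ Finset.Ico 1 m, P * (1 + 4 * q) ^ (-((m : ℝ) / 4)) := by
        rw [norm_mul, norm_inv, Complex.norm_natCast]
        gcongr
        refine (norm_sum_le _ _).trans (Finset.sum_le_sum fun r hr => ?_)
        rw [norm_mul, norm_pow, norm_pow, hζ.norm'_eq_one hm0, one_pow, one_pow, one_mul]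
        exact norm_prod_inv_le hr hζ hq hx0 hx hxm
    _ ≤ (m : ℝ)⁻¹ * (m * (P * (1 + 4 * q) ^ (-((m : ℝ) / 4)))) := by
        rw [Finset.sum_const, nsmul_eq_mul, Nat.card_Ico]
        gcongr
        omega
    _ = P * (1 + 4 * q) ^ (-((m : ℝ) / 4)) := by field_simp

/-- Rankin's trick: the tail is bounded by the generating function at `y = √x`. -/
lemma tsum_tail_le {m j : ℕ} (hm : 2 ≤ m) (hjm : j ≤ m) (L : ℕ)
    {y : ℝ} (hy0 : 0 < y) (hy : y < 1) :
    ∑' l : ℕ, (numPart ((l + L + 1) * m - j) (m - 1) : ℝ) * (y ^ 2) ^ ((l + L + 1) * m - j) ≤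
      (∏ i ∈ Finset.range (m - 1), (1 - (y ^ 2) ^ (i + 1))⁻¹) * (2 ^ m * y ^ (L * m)) := by
  have hinj : Function.Injective fun l : ℕ => (l + L + 1) * m - j :=
    (add_one_mul_sub_injective (by omega) hjm).comp (add_left_injective L)
  have hy2 : y ^ 2 < 1 := pow_lt_one₀ hy0.le hy (by omega)
  have hsum := hasSum_numPart_mul_pow_real (m - 1) hy0.le hy
  have hsum2 := hasSum_numPart_mul_pow_real (m - 1) (x := y ^ 2) (by positivity) hy2
  have hprod : ∏ i ∈ Finset.range (m - 1), (1 - y ^ (i + 1))⁻¹ ≤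
      (∏ i ∈ Finset.range (m - 1), (1 - (y ^ 2) ^ (i + 1))⁻¹) * 2 ^ m := by
    have h2 : (2 : ℝ) ^ (m - 1) ≤ 2 ^ m := pow_le_pow_right₀ one_le_two (by omega)
    refine le_trans ?_ (mul_le_mul_of_nonneg_left h2
      (prod_inv_pos (by positivity) hy2 (m - 1)).le)
    have : (2 : ℝ) ^ (m - 1) = ∏ i ∈ Finset.range (m - 1), (2 : ℝ) := by simp
    rw [this, ← Finset.prod_mul_distrib]
    refine Finset.prod_le_prod (fun i _ => ?_) fun i _ => ?_
    · exact inv_nonneg.2 (sub_nonneg.2 (pow_le_one₀ hy0.le hy.le))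
    · have h1 : y ^ (i + 1) < 1 := pow_lt_one₀ hy0.le hy (by omega)
      have h0 : 0 < y ^ (i + 1) := by positivity
      have h3 : 1 - (y ^ 2) ^ (i + 1) = (1 - y ^ (i + 1)) * (1 + y ^ (i + 1)) := by ring
      rw [h3, mul_inv, mul_assoc]
      refine le_mul_of_one_le_right (inv_nonneg.2 (by linarith)) ?_
      rw [inv_mul_eq_div, one_le_div (by linarith)]
      linarith
  have hterm : ∀ l : ℕ,
      (numPart ((l + L + 1) * m - j) (m - 1) : ℝ) * (y ^ 2) ^ ((l + L + 1) * m - j) ≤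
        (numPart ((l + L + 1) * m - j) (m - 1) : ℝ) * y ^ ((l + L + 1) * m - j) *
          y ^ (L * m) := by
    intro l
    have hle : L * m ≤ (l + L + 1) * m - j := by
      have : (l + L + 1) * m = l * m + L * m + m := by ring
      omega
    rw [← pow_mul, mul_comm 2, pow_mul, sq, ← mul_assoc]
    gcongr _ * ?_
    exact pow_le_pow_of_le_one hy0.le hy.le hle
  have hs1 : Summable fun l : ℕ =>
      (numPart ((l + L + 1) * m - j) (m - 1) : ℝ) * y ^ ((l + L + 1) * m - j) :=
    hsum.summable.comp_injective hinj
  calc _ ≤ ∑' l : ℕ, (numPart ((l + L + 1) * m - j) (m - 1) : ℝ) *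
          y ^ ((l + L + 1) * m - j) * y ^ (L * m) :=
        (hsum2.summable.comp_injective hinj).tsum_le_tsum hterm (hs1.mul_right _)
    _ = (∑' l : ℕ, (numPart ((l + L + 1) * m - j) (m - 1) : ℝ) *
          y ^ ((l + L + 1) * m - j)) * y ^ (L * m) := tsum_mul_right
    _ ≤ (∏ i ∈ Finset.range (m - 1), (1 - y ^ (i + 1))⁻¹) * y ^ (L * m) := by
        gcongr
        rw [← hsum.tsum_eq]
        exact tsum_comp_le_tsum_of_inj hsum.summable (fun _ => by positivity) hinj
    _ ≤ _ := by
        rw [← mul_assoc]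
        gcongr

/-- Quantitative comparison of the truncated sum with its main term. -/
lemma abs_sum_sub_le {m j : ℕ} (hm : 2 ≤ m) (hj1 : 1 ≤ j) (hjm : j ≤ m) (L : ℕ)
    {q lam : ℝ} (hlam : 0 < lam) (hq : q = Real.exp (-lam)) :
    |∑ l ∈ Finset.Icc 1 L, q ^ l * (numPart (l * m - j) (m - 1) : ℝ) -
        Real.exp (-lam / m) ^ j *
          (∏ i ∈ Finset.range (m - 1), (1 - Real.exp (-lam / m) ^ (i + 1))⁻¹) / m| ≤
      Real.exp (-lam / m) ^ j *
          (∏ i ∈ Finset.range (m - 1), (1 - Real.exp (-lam / m) ^ (i + 1))⁻¹) / m *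
        (m * (1 + 4 * q) ^ (-((m : ℝ) / 4)) + m * (2 ^ m * Real.exp (-lam * L / 2))) := by
  have hmpos : (0 : ℝ) < m := by positivity
  set x := Real.exp (-lam / m) with hxdef
  set y := Real.exp (-lam / (2 * m)) with hydef
  have hx0 : 0 < x := Real.exp_pos _
  have hy0 : 0 < y := Real.exp_pos _
  have hx1 : x < 1 := Real.exp_lt_one_iff.2 (div_neg_of_neg_of_pos (by linarith) hmpos)
  have hy1 : y < 1 := Real.exp_lt_one_iff.2 (div_neg_of_neg_of_pos (by linarith) (by positivity))
  have hxy : x = y ^ 2 := by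
    rw [hxdef, hydef, ← Real.exp_nat_mul]; congr 1; push_cast; field_simp
  have hxm : x ^ m = q := by
    rw [hxdef, hq, ← Real.exp_nat_mul]; congr 1; field_simp
  have hyL : y ^ (L * m) = Real.exp (-lam * L / 2) := by
    rw [hydef, ← Real.exp_nat_mul]; congr 1; push_cast; field_simp
  have hq0 : 0 < q := hq ▸ Real.exp_pos _
  set P := ∏ i ∈ Finset.range (m - 1), (1 - x ^ (i + 1))⁻¹ with hP
  set A : ℕ → ℝ := fun l => (numPart ((l + 1) * m - j) (m - 1) : ℝ) * x ^ ((l + 1) * m - j)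
    with hA
  have hAs : Summable A := (hasSum_numPart_mul_pow_real (m - 1) hx0.le hx1).summable.comp_injective
    (add_one_mul_sub_injective (by omega) hjm)
  have hsum : ∑ l ∈ Finset.Icc 1 L, q ^ l * (numPart (l * m - j) (m - 1) : ℝ) =
      x ^ j * ∑ l ∈ Finset.range L, A l := by
    rw [Finset.mul_sum, Finset.range_eq_Ico, Finset.sum_Ico_add' (fun l =>
      x ^ j * ((numPart (l * m - j) (m - 1) : ℝ) * x ^ (l * m - j))) 0 L 1]
    refine Finset.sum_congr (by ext; simp) fun l hl => ?_
    have hl1 : j ≤ l * m := hjm.trans (Nat.le_mul_of_pos_left _ (Finset.mem_Ico.1 hl).1)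
    have : q ^ l = x ^ j * x ^ (l * m - j) := by
      rw [← pow_add, Nat.add_sub_cancel' hl1, ← hxm, ← pow_mul, mul_comm]
    rw [this]; ring
  have hfull := abs_tsum_arith_progression_sub_le hm hj1 hjm hq0 hx0 hx1 hxm
  have htail := tsum_tail_le hm hjm L hy0 hy1
  rw [← hxy, ← hP, hyL] at htail
  have htail0 : 0 ≤ ∑' l : ℕ, A (l + L) := tsum_nonneg fun _ => by positivity
  have hdec := hAs.sum_add_tsum_nat_add L
  have hT : ∑ l ∈ Finset.range L, A l - P / m = (∑' l, A l - P / m) - ∑' l : ℕ, A (l + L) := by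
    rw [← hdec]; ring
  rw [hsum]
  calc |x ^ j * ∑ l ∈ Finset.range L, A l - x ^ j * P / m|
      = x ^ j * |∑ l ∈ Finset.range L, A l - P / m| := by
        rw [mul_div_assoc, ← mul_sub, abs_mul, abs_of_pos (by positivity : 0 < x ^ j)]
    _ ≤ x ^ j * (P * (1 + 4 * q) ^ (-((m : ℝ) / 4)) +
          P * (2 ^ m * Real.exp (-lam * L / 2))) := by
        gcongr
        rw [hT]
        refine (abs_sub _ _).trans (add_le_add hfull ?_)
        rw [abs_of_nonneg htail0]
        exact htail
    _ = _ := by field_simp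

/-- The smooth function `u ↦ log ((1 - e⁻ᵘ) / u)`, extended by `0` at `u = 0`. -/
noncomputable def logSlope (u : ℝ) : ℝ :=
  Real.log (dslope (fun u : ℝ => 1 - Real.exp (-u)) 0 u)

lemma dslope_one_sub_exp_of_ne {u : ℝ} (hu : u ≠ 0) :
    dslope (fun u : ℝ => 1 - Real.exp (-u)) 0 u = (1 - Real.exp (-u)) / u := by
  rw [dslope_of_ne _ hu, slope_def_field]; simp

lemma dslope_one_sub_exp_zero : dslope (fun u : ℝ => 1 - Real.exp (-u)) 0 0 = 1 := by
  rw [dslope_same]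
  have : HasDerivAt (fun u : ℝ => 1 - Real.exp (-u)) (-(Real.exp (-0) * -1)) 0 :=
    ((hasDerivAt_neg (0 : ℝ)).exp).const_sub 1
  simpa using this.deriv

lemma dslope_one_sub_exp_pos (u : ℝ) : 0 < dslope (fun u : ℝ => 1 - Real.exp (-u)) 0 u := by
  rcases lt_trichotomy u 0 with h | rfl | h
  · rw [dslope_one_sub_exp_of_ne h.ne]
    exact div_pos_of_neg_of_neg (sub_neg.2 (Real.one_lt_exp_iff.2 (by linarith))) h
  · rw [dslope_one_sub_exp_zero]; exact one_pos
  · rw [dslope_one_sub_exp_of_ne h.ne']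
    exact div_pos (sub_pos.2 (Real.exp_lt_one_iff.2 (by linarith))) h

lemma contDiff_logSlope : ContDiff ℝ 2 logSlope := by
  refine ContDiff.log (contDiff_iff_contDiffAt.2 fun u => ?_)
    fun u => (dslope_one_sub_exp_pos u).ne'
  rcases eq_or_ne u 0 with rfl | hu
  · have h : AnalyticAt ℝ (fun u : ℝ => 1 - Real.exp (-u)) 0 := by fun_prop
    obtain ⟨p, hp⟩ := h
    exact hp.has_fpower_series_dslope_fslope.analyticAt.contDiffAt
  · have h : ContDiffAt ℝ 2 (fun u : ℝ => (1 - Real.exp (-u)) / u) u := by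
      refine ContDiffAt.div ?_ contDiffAt_id hu
      fun_prop
    refine h.congr_of_eventuallyEq ?_
    filter_upwards [isOpen_ne.mem_nhds hu] with v hv
    exact dslope_one_sub_exp_of_ne hv

lemma exp_logSlope {u : ℝ} (hu : u ≠ 0) : u * Real.exp (logSlope u) = 1 - Real.exp (-u) := by
  rw [logSlope, Real.exp_log (dslope_one_sub_exp_pos u), dslope_one_sub_exp_of_ne hu]
  field_simp

lemma logSlope_zero : logSlope 0 = 0 := by
  rw [logSlope, dslope_one_sub_exp_zero, Real.log_one]

lemma logSlope_of_pos {u : ℝ} (hu : 0 < u) :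
    logSlope u = Real.log (1 - Real.exp (-u)) - Real.log u := by
  rw [logSlope, dslope_one_sub_exp_of_ne hu.ne', Real.log_div _ hu.ne']
  exact (sub_pos.2 (Real.exp_lt_one_iff.2 (by linarith))).ne'

lemma mul_deriv_logSlope (u : ℝ) (hu : 0 < u) :
    u * deriv logSlope u = u / (Real.exp u - 1) - 1 := by
  have h1 : 0 < 1 - Real.exp (-u) := sub_pos.2 (Real.exp_lt_one_iff.2 (by linarith))
  have hd : HasDerivAt (fun u : ℝ => 1 - Real.exp (-u)) (-(Real.exp (-u) * -1)) u :=
    ((hasDerivAt_neg u).exp).const_sub 1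
  have h2 : HasDerivAt (fun u => Real.log (1 - Real.exp (-u)) - Real.log u)
      (-(Real.exp (-u) * -1) / (1 - Real.exp (-u)) - u⁻¹) u :=
    (hd.log h1.ne').sub (Real.hasDerivAt_log hu.ne')
  have h3 : logSlope =ᶠ[nhds u] fun u => Real.log (1 - Real.exp (-u)) - Real.log u := by
    filter_upwards [lt_mem_nhds hu] with v hv using logSlope_of_pos hv
  rw [h3.deriv_eq, h2.deriv]
  have h4 : 0 < Real.exp u - 1 := sub_pos.2 (Real.one_lt_exp_iff.2 hu)
  have h5 : 1 - Real.exp (-u) = (Real.exp u - 1) * Real.exp (-u) := by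
    rw [sub_mul, ← Real.exp_add]; simp
  have h6 := Real.exp_pos (-u)
  rw [h5]
  field_simp

lemma intervalIntegrable_div_exp_sub_one {lam : ℝ} (hlam : 0 < lam) :
    IntervalIntegrable (fun s => s / (Real.exp s - 1)) MeasureTheory.volume 0 lam := by
  have hc : Continuous fun u => u * deriv logSlope u + 1 :=
    (continuous_id.mul (contDiff_logSlope.continuous_deriv (by norm_num))).add continuous_const
  refine (hc.intervalIntegrable 0 lam).congr fun u hu => ?_
  rw [Set.uIoc_of_le hlam.le] at hu
  simp [mul_deriv_logSlope u hu.1]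

lemma integral_logSlope {lam : ℝ} (hlam : 0 < lam) :
    ∫ u in (0 : ℝ)..lam, logSlope u =
      lam * logSlope lam - (∫ s in (0 : ℝ)..lam, s / (Real.exp s - 1)) + lam := by
  have hW : Differentiable ℝ logSlope := contDiff_logSlope.differentiable (by norm_num)
  have hc : Continuous (deriv logSlope) := contDiff_logSlope.continuous_deriv (by norm_num)
  have h := intervalIntegral.integral_mul_deriv_eq_deriv_mul (a := 0) (b := lam)
    (u := logSlope) (v := fun u => u) (u' := deriv logSlope) (v' := fun _ => 1)
    (fun u _ => (hW u).hasDerivAt) (fun u _ => hasDerivAt_id u)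
    (hc.intervalIntegrable _ _) (continuous_const.intervalIntegrable _ _)
  have h2 : ∫ u in (0 : ℝ)..lam, deriv logSlope u * u =
      ∫ u in (0 : ℝ)..lam, (u / (Real.exp u - 1) - 1) := by
    refine intervalIntegral.integral_congr_ae (Eventually.of_forall fun u hu => ?_)
    rw [Set.uIoc_of_le hlam.le] at hu
    rw [mul_comm, mul_deriv_logSlope u hu.1]
  rw [h2, intervalIntegral.integral_sub (intervalIntegrable_div_exp_sub_one hlam)
    (continuous_const.intervalIntegrable _ _)] at h
  simp only [mul_one, intervalIntegral.integral_const, smul_eq_mul, sub_zero] at h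
  rw [h]; ring

/-- The Euler–Maclaurin formula to first order, for a twice differentiable function. -/
lemma tendsto_sum_sub_integral {W : ℝ → ℝ} (hW : ContDiff ℝ 2 W) {lam : ℝ} (hlam : 0 < lam) :
    Tendsto (fun m : ℕ => ∑ i ∈ Finset.range (m - 1), W ((i + 1) * lam / m) -
      m / lam * ∫ u in (0 : ℝ)..lam, W u) atTop (nhds (-((W 0 + W lam) / 2))) := by
  have hu : UniqueDiffOn ℝ (Set.uIcc 0 lam) := by
    rw [Set.uIcc_of_le hlam.le]; exact uniqueDiffOn_Icc hlam
  obtain ⟨C, hC⟩ := isCompact_uIcc.exists_bound_of_continuousOn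
    (hW.contDiffOn.continuousOn_iteratedDerivWithin (m := 2) le_rfl hu)
  have hbound : ∀ x, |iteratedDerivWithin 2 W (Set.uIcc 0 lam) x| ≤ |C| := by
    intro x
    by_cases hx : x ∈ Set.uIcc 0 lam
    · exact (hC x hx).trans (le_abs_self C)
    · rw [iteratedDerivWithin_succ, derivWithin_zero_of_notMem_closure]
      · simp
      · rwa [isCompact_uIcc.isClosed.closure_eq]
  have herr : Tendsto (fun m : ℕ => (m : ℝ) / lam * trapezoidal_error W m 0 lam) atTop
      (nhds 0) := by
    have hlim : Tendsto (fun m : ℕ => lam ^ 2 * |C| / 12 * (m : ℝ)⁻¹) atTop (nhds 0) := by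
      simpa using (tendsto_inv_atTop_nhds_zero_nat (𝕜 := ℝ)).const_mul (lam ^ 2 * |C| / 12)
    refine squeeze_zero_norm' ?_ hlim
    filter_upwards [eventually_gt_atTop 0] with m hm
    have hm' : (0 : ℝ) < m := by exact_mod_cast hm
    have := trapezoidal_error_le_of_c2 hW.contDiffOn hbound hm
    rw [sub_zero, abs_of_pos hlam] at this
    rw [norm_mul, Real.norm_eq_abs, Real.norm_eq_abs, abs_of_pos (by positivity)]
    calc _ ≤ (m : ℝ) / lam * (lam ^ 3 * |C| / (12 * m ^ 2)) := by gcongr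
      _ = _ := by field_simp
  have := herr.sub_const ((W 0 + W lam) / 2)
  rw [zero_sub] at this
  refine this.congr' ?_
  filter_upwards [eventually_gt_atTop 0] with m hm
  have hm' : (0 : ℝ) < m := by exact_mod_cast hm
  simp only [trapezoidal_error, trapezoidal_integral, sub_zero, zero_add]
  field_simp
  ring

/-- Asymptotics of the partition generating function at `e^{-lam/m}`. -/
lemma tendsto_prod_inv {lam : ℝ} (hlam : 0 < lam) :
    Tendsto (fun m : ℕ => (∏ i ∈ Finset.range (m - 1), (1 - Real.exp (-lam / m) ^ (i + 1))⁻¹) *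
        √m * Real.exp (-(m * ((∫ s in (0 : ℝ)..lam, s / (Real.exp s - 1)) / lam -
          Real.log (1 - Real.exp (-lam)))))) atTop
      (nhds (√(lam * (1 - Real.exp (-lam)) / (2 * Real.pi)))) := by
  have h1 := (Real.continuous_exp.tendsto _).comp
    (tendsto_sum_sub_integral contDiff_logSlope hlam).neg
  have h2 := (Stirling.tendsto_stirlingSeq_sqrt_pi.const_mul (√2)).inv₀
    (by positivity)
  have h3 := ((h1.mul h2).const_mul lam)
  have hval : lam * (Real.exp (- -((logSlope 0 + logSlope lam) / 2)) * (√2 * √Real.pi)⁻¹) =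
      √(lam * (1 - Real.exp (-lam)) / (2 * Real.pi)) := by
    rw [← exp_logSlope hlam.ne', logSlope_zero, neg_neg, zero_add, Real.exp_half,
      Real.sqrt_div (by positivity), Real.sqrt_mul hlam.le, Real.sqrt_mul hlam.le, ← mul_assoc,
      ← mul_assoc, Real.mul_self_sqrt hlam.le, Real.sqrt_mul zero_le_two, div_eq_mul_inv]
  rw [hval] at h3
  refine h3.congr' ?_
  filter_upwards [eventually_gt_atTop 0] with m hm
  have hm' : (0 : ℝ) < m := by exact_mod_cast hm
  have hprod : ∏ i ∈ Finset.range (m - 1), (1 - Real.exp (-lam / m) ^ (i + 1)) =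
      (lam / m) ^ (m - 1) * (m - 1).factorial *
        Real.exp (∑ i ∈ Finset.range (m - 1), logSlope ((i + 1) * lam / m)) := by
    have : ∀ i ∈ Finset.range (m - 1), 1 - Real.exp (-lam / m) ^ (i + 1) =
        (lam / m) * ((i + 1 : ℕ) : ℝ) * Real.exp (logSlope ((i + 1) * lam / m)) := by
      intro i _
      have hne : ((i : ℝ) + 1) * lam / m ≠ 0 := by positivity
      rw [← Real.exp_nat_mul]
      have e := exp_logSlope hne
      have e2 : ((i + 1 : ℕ) : ℝ) * (-lam / m) = -(((i : ℝ) + 1) * lam / m) := by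
        push_cast; ring
      rw [e2, ← e]; push_cast; ring
    rw [Finset.prod_congr rfl this, Finset.prod_mul_distrib, Finset.prod_mul_distrib,
      Real.exp_sum, Finset.prod_const, Finset.card_range, ← Nat.cast_prod,
      Finset.prod_range_add_one_eq_factorial]
  have hpsi : -(m * ((∫ s in (0 : ℝ)..lam, s / (Real.exp s - 1)) / lam -
      Real.log (1 - Real.exp (-lam)))) =
      m / lam * (∫ u in (0 : ℝ)..lam, logSlope u) + m * Real.log lam - m := by
    rw [integral_logSlope hlam, logSlope_of_pos hlam]
    field_simp
    ring
  obtain ⟨k, rfl⟩ : ∃ k, m = k + 1 := ⟨m - 1, by omega⟩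
  rw [Finset.prod_inv_distrib, hprod, hpsi, Stirling.stirlingSeq, Real.exp_sub, Real.exp_add,
    Real.exp_nat_mul (Real.log lam), Real.exp_log hlam, Function.comp_apply, neg_sub,
    Real.exp_sub, Nat.factorial_succ]
  have hexp : Real.exp ((k + 1 : ℕ) : ℝ) = Real.exp 1 ^ (k + 1) := by
    rw [← Real.exp_nat_mul, mul_one]
  have hsq : √((2 : ℝ) * (k + 1 : ℕ)) = √2 * √((k + 1 : ℕ) : ℝ) := Real.sqrt_mul (by norm_num) _
  have hspos : 0 < √((k + 1 : ℕ) : ℝ) := Real.sqrt_pos.2 hm'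
  rw [hexp, hsq, Nat.cast_mul]
  set s := √((k + 1 : ℕ) : ℝ)
  set t : ℝ := ((k + 1 : ℕ) : ℝ)
  simp only [Nat.add_sub_cancel]
  have hf : ((k.factorial : ℕ) : ℝ) ≠ 0 := by positivity
  field_simp
  rw [div_pow, div_pow]
  field_simp
  ring

lemma sq_div_two_lt_integral_mul {lam : ℝ} (hlam : 0 < lam) :
    lam ^ 2 / 2 < (∫ s in (0 : ℝ)..lam, s / (Real.exp s - 1)) * (Real.exp lam - 1) := by
  have hE : 0 < Real.exp lam - 1 := sub_pos.2 (Real.one_lt_exp_iff.2 hlam)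
  have hint := intervalIntegrable_div_exp_sub_one hlam
  have hint2 : IntervalIntegrable (fun s : ℝ => s / (Real.exp lam - 1))
      MeasureTheory.volume 0 lam := (continuous_id.div_const _).intervalIntegrable _ _
  have h := intervalIntegral.intervalIntegral_pos_of_pos_on (hint.sub hint2)
    (fun s hs => by
      have h1 : 0 < Real.exp s - 1 := sub_pos.2 (Real.one_lt_exp_iff.2 hs.1)
      have h2 : Real.exp s < Real.exp lam := Real.exp_lt_exp.2 hs.2
      exact sub_pos.2 (div_lt_div_of_pos_left hs.1 h1 (by linarith))) hlam
  rw [intervalIntegral.integral_sub hint hint2, intervalIntegral.integral_div, integral_id,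
    sub_pos, div_lt_iff₀ hE] at h
  linarith

/-- Simplification of the constant in front of the asymptotic formula. -/
lemma szekeres_const_eq {lam I t₀ F g₀ ψ₀ ψ₂ : ℝ} (hlam : 0 < lam)
    (hI : lam ^ 2 / 2 < I * (Real.exp lam - 1))
    (ht₀ : t₀ = lam / Real.sqrt I)
    (hF : F = lam / (2 ^ ((3 : ℝ) / 2) * Real.pi * t₀) *
      (Real.sqrt (1 - Real.exp (-lam) - t₀ ^ 2 * Real.exp (-lam) / 2))⁻¹)
    (hg₀ : g₀ = 2 * lam / t₀ - t₀ * Real.log (1 - Real.exp (-lam)))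
    (hψ₀ : ψ₀ = g₀ / t₀ - lam / t₀ ^ 2)
    (hψ₂ : ψ₂ = -2 * lam * (Real.exp lam - 1) /
      (t₀ ^ 4 * (Real.exp lam - 1 - t₀ ^ 2 / 2))) :
    ψ₀ = I / lam - Real.log (1 - Real.exp (-lam)) ∧
    F / t₀ * Real.exp (lam / t₀ ^ 2 - ψ₀) * √(8 * Real.pi / |ψ₂|) =
      √(lam * (1 - Real.exp (-lam)) / (2 * Real.pi)) := by
  have hE' : 0 < Real.exp lam - 1 := sub_pos.2 (Real.one_lt_exp_iff.2 hlam)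
  have hE : 0 < 1 - Real.exp (-lam) := sub_pos.2 (Real.exp_lt_one_iff.2 (by linarith))
  have hI0 : 0 < I := pos_of_mul_pos_left (lt_trans (by positivity) hI) hE'.le
  have ht0 : 0 < t₀ := ht₀ ▸ div_pos hlam (Real.sqrt_pos.2 hI0)
  have ht2 : t₀ ^ 2 = lam ^ 2 / I := by rw [ht₀, div_pow, Real.sq_sqrt hI0.le]
  have hexp : Real.exp lam * Real.exp (-lam) = 1 := by rw [← Real.exp_add]; simp
  have hpos := Real.exp_pos (-lam)
  have hDpos : 0 < Real.exp lam - 1 - t₀ ^ 2 / 2 := by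
    rw [ht2, sub_pos, div_div, div_lt_iff₀ (by positivity)]; linarith
  set w := Real.exp (-lam) with hw
  set D := 1 - w - t₀ ^ 2 * w / 2 with hD
  have hDw : D = (Real.exp lam - 1 - t₀ ^ 2 / 2) * w := by
    rw [hD]; linear_combination -hexp
  have hD0 : 0 < D := hDw ▸ mul_pos hDpos hpos
  have hψ : ψ₀ = lam / t₀ ^ 2 - Real.log (1 - w) := by
    rw [hψ₀, hg₀]; field_simp; ring
  have hψabs : |ψ₂| = 2 * lam * (1 - w) / (t₀ ^ 4 * D) := by
    have h1 : 1 - w = (Real.exp lam - 1) * w := by linear_combination -hexp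
    rw [hψ₂, neg_mul, neg_mul, neg_div, abs_neg, abs_of_pos (by positivity), h1, hDw]
    field_simp
  refine ⟨by rw [hψ, ht2]; field_simp, ?_⟩
  have h32 : ((2 : ℝ) ^ ((3 : ℝ) / 2)) ^ 2 = 8 := by
    rw [← Real.rpow_natCast, ← Real.rpow_mul zero_le_two]; norm_num
  have h32pos : (0 : ℝ) < 2 ^ ((3 : ℝ) / 2) := Real.rpow_pos_of_pos two_pos _
  have hpi := Real.pi_pos
  have hF0 : 0 < F := by
    rw [hF]
    have := Real.sqrt_pos.2 hD0
    positivity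
  have hlog : lam / t₀ ^ 2 - ψ₀ = Real.log (1 - w) := by rw [hψ]; ring
  rw [hlog, Real.exp_log hE, hψabs]
  refine (sq_eq_sq₀ (by positivity) (by positivity)).1 ?_
  rw [mul_pow, mul_pow, div_pow, hF, mul_pow, div_pow, mul_pow, mul_pow, inv_pow, h32,
    Real.sq_sqrt hD0.le, Real.sq_sqrt (by positivity), Real.sq_sqrt (by positivity)]
  field_simp

lemma residue_bounds {n m j : ℕ} (hm : 0 < m)
    (hj : (j : ℤ) = (m : ℤ) + (n : ℤ) - (m : ℤ) * ⌈(n : ℚ) / (m : ℚ)⌉) : 1 ≤ j ∧ j ≤ m := by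
  have hm' : (0 : ℚ) < m := by exact_mod_cast hm
  have h1 := Int.le_ceil ((n : ℚ) / m)
  have h2 := Int.ceil_lt_add_one ((n : ℚ) / m)
  set c := ⌈(n : ℚ) / (m : ℚ)⌉
  rw [div_le_iff₀ hm'] at h1
  rw [← sub_lt_iff_lt_add, lt_div_iff₀ hm'] at h2
  have h1' : (n : ℤ) ≤ c * m := by exact_mod_cast h1
  have h2' : (c - 1) * (m : ℤ) < n := by exact_mod_cast h2
  constructor
  · have : (0 : ℤ) < j := by rw [hj]; linarith
    exact_mod_cast this
  · have : (j : ℤ) ≤ m := by rw [hj]; linarith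
    exact_mod_cast this

lemma eventually_mul_le_truncation {m : ℕ → ℕ} (hm2 : ∀ n, 2 ≤ m n)
    (hmo : (fun n => (m n : ℝ)) =o[atTop] fun n => (n : ℝ) ^ ((1 : ℝ) / 3))
    {M : ℕ → ℤ}
    (hM : ∀ n : ℕ, M n = ⌊((n : ℝ) / (m n : ℝ) - (m n : ℝ)) / ((m n : ℝ) - 1)⌋)
    {K : ℝ} (hK : 0 < K) :
    ∀ᶠ n in atTop, K * m n ≤ ((M n + 1).toNat : ℝ) := by
  filter_upwards [hmo.bound (show 0 < 1 / (1 + K) by positivity)] with n hn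
  have hm : (2 : ℝ) ≤ m n := by exact_mod_cast hm2 n
  rw [Real.norm_of_nonneg (by positivity), Real.norm_of_nonneg (by positivity),
    div_mul_eq_mul_div, one_mul, le_div_iff₀ (by positivity)] at hn
  have hcube : ((m n : ℝ) * (1 + K)) ^ 3 ≤ n := by
    calc ((m n : ℝ) * (1 + K)) ^ 3 ≤ ((n : ℝ) ^ ((1 : ℝ) / 3)) ^ 3 := by gcongr
      _ = (n : ℝ) := by rw [← Real.rpow_natCast, ← Real.rpow_mul (by positivity)]; norm_num
  have hK3 : 1 + K ≤ (1 + K) ^ 3 := le_self_pow₀ (by linarith) (by norm_num)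
  have hn3 : (m n : ℝ) ^ 3 * (1 + K) ≤ n := by
    refine le_trans ?_ hcube
    rw [mul_pow]; gcongr
  have hle : K * m n ≤ ((n : ℝ) / m n - m n) / ((m n : ℝ) - 1) := by
    rw [le_div_iff₀ (by linarith), le_sub_iff_add_le, le_div_iff₀ (by linarith)]
    have h3 : (m n : ℝ) ^ 2 ≤ (m n : ℝ) ^ 3 := pow_le_pow_right₀ (by linarith) (by norm_num)
    nlinarith [mul_nonneg hK.le (sq_nonneg (m n : ℝ))]
  have hfl := Int.lt_floor_add_one (((n : ℝ) / m n - m n) / ((m n : ℝ) - 1))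
  rw [← hM n] at hfl
  have hto : ((M n + 1 : ℤ) : ℝ) ≤ (((M n + 1).toNat : ℤ) : ℝ) :=
    Int.cast_le.2 (Int.self_le_toNat _)
  push_cast at hto
  linarith

/-- The relative error of the truncated sum with respect to its main term vanishes. -/
lemma tendsto_relative_error {m : ℕ → ℕ} (hminf : Tendsto m atTop atTop) {L : ℕ → ℕ}
    {q lam : ℝ} (hq : 0 < q) (hlam : 0 < lam)
    (hL : ∀ᶠ n in atTop, 4 / lam * m n ≤ (L n : ℝ)) :
    Tendsto (fun n => (m n : ℝ) * (1 + 4 * q) ^ (-((m n : ℝ) / 4)) +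
      m n * (2 ^ m n * Real.exp (-lam * L n / 2))) atTop (nhds 0) := by
  rw [← add_zero (0 : ℝ)]
  refine Tendsto.add ?_ ?_
  · set r : ℝ := (1 + 4 * q) ^ (-(1 / 4) : ℝ)
    have hr : r < 1 := Real.rpow_lt_one_of_one_lt_of_neg (by linarith) (by norm_num)
    have hr0 : 0 ≤ r := Real.rpow_nonneg (by linarith) _
    refine ((tendsto_self_mul_const_pow_of_lt_one hr0 hr).comp hminf).congr fun n => ?_
    simp only [Function.comp_apply, r]
    rw [← Real.rpow_natCast, ← Real.rpow_mul (by linarith)]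
    congr 2
    ring
  · have hr : Real.exp (-1) < 1 := Real.exp_lt_one_iff.2 (by norm_num)
    refine squeeze_zero' (Eventually.of_forall fun n => by positivity) ?_
      ((tendsto_self_mul_const_pow_of_lt_one (Real.exp_pos (-1)).le hr).comp hminf)
    filter_upwards [hL] with n hn
    simp only [Function.comp_apply]
    gcongr
    have h2 : (2 : ℝ) ^ m n ≤ Real.exp 1 ^ m n := by
      gcongr
      have := Real.add_one_le_exp (1 : ℝ)
      linarith
    calc (2 : ℝ) ^ m n * Real.exp (-lam * L n / 2)
        ≤ Real.exp 1 ^ m n * Real.exp (-2 * m n) := by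
          gcongr ?_ * Real.exp ?_
          have := mul_le_mul_of_nonneg_left hn hlam.le
          have h3 : lam * (4 / lam * m n) = 4 * m n := by field_simp
          linarith
      _ = Real.exp (-1) ^ m n := by
          rw [← Real.exp_nat_mul, ← Real.exp_nat_mul, ← Real.exp_add]
          congr 1
          ring

/-- Laplace-method asymptotics for the normalizing sum: with `q ∈ (0,1)`,
`λ = -log q`, `I = ∫₀^λ s/(eˢ-1) ds`, `t₀ = λ/√I`, `m = m_n → ∞`, `m = o(n^{1/3})`,
`j = m + n - m⌈n/m⌉` and `M_n = ⌊(n/m - m)/(m-1)⌋`, one has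
`Σ_{l=1}^{M_n+1} q^l |𝒫_{lm-j}(m-1)|
   ~ (f(t₀)/t₀) e^{λt₀⁻² - ψ(t₀) - λj/m} √(8π/|ψ″(t₀)|) e^{mψ(t₀)}/m^{3/2}`,
where `f`, `g` are the Szekeres functions evaluated at `t₀` (so `v(t₀) = λ`) and
`ψ(t) = g(t)/t - λ/t²`, with `ψ″(t₀) = -2λ(e^λ-1)/(t₀⁴(e^λ-1-t₀²/2))`. -/
theorem stmt_19 (q : ℝ) (hq : q ∈ Set.Ioo (0 : ℝ) 1) (lam : ℝ) (hlam : lam = -Real.log q)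
    (m : ℕ → ℕ) (hm2 : ∀ n, 2 ≤ m n) (hminf : Tendsto m atTop atTop)
    (hmo : (fun n => (m n : ℝ)) =o[atTop] fun n => (n : ℝ) ^ ((1 : ℝ) / 3))
    (j : ℕ → ℕ)
    (hj : ∀ n : ℕ, (j n : ℤ) = (m n : ℤ) + (n : ℤ) - (m n : ℤ) * ⌈(n : ℚ) / (m n : ℚ)⌉)
    (M : ℕ → ℤ)
    (hM : ∀ n : ℕ, M n = ⌊((n : ℝ) / (m n : ℝ) - (m n : ℝ)) / ((m n : ℝ) - 1)⌋)
    (I t₀ F g₀ ψ₀ ψ₂ : ℝ)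
    (hI : I = ∫ s in (0 : ℝ)..lam, s / (Real.exp s - 1))
    (ht₀ : t₀ = lam / Real.sqrt I)
    (hF : F = lam / (2 ^ ((3 : ℝ) / 2) * Real.pi * t₀) *
      (Real.sqrt (1 - Real.exp (-lam) - t₀ ^ 2 * Real.exp (-lam) / 2))⁻¹)
    (hg₀ : g₀ = 2 * lam / t₀ - t₀ * Real.log (1 - Real.exp (-lam)))
    (hψ₀ : ψ₀ = g₀ / t₀ - lam / t₀ ^ 2)
    (hψ₂ : ψ₂ = -2 * lam * (Real.exp lam - 1) /
      (t₀ ^ 4 * (Real.exp lam - 1 - t₀ ^ 2 / 2))) :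
    Tendsto (fun n : ℕ =>
        (∑ l ∈ Finset.Icc 1 ((M n + 1).toNat),
          q ^ l * (numPart (l * m n - j n) (m n - 1) : ℝ)) /
        (F / t₀ *
          Real.exp (lam / t₀ ^ 2 - ψ₀ - lam * (j n : ℝ) / (m n : ℝ)) *
          Real.sqrt (8 * Real.pi / |ψ₂|) *
          Real.exp ((m n : ℝ) * ψ₀) / (m n : ℝ) ^ ((3 : ℝ) / 2)))
      atTop (nhds 1) := by
  have hlam0 : 0 < lam := by rw [hlam]; exact neg_pos.2 (Real.log_neg hq.1 hq.2)
  have hqe : q = Real.exp (-lam) := by rw [hlam, neg_neg, Real.exp_log hq.1]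
  obtain ⟨hψ, hconst⟩ := szekeres_const_eq hlam0 (hI ▸ sq_div_two_lt_integral_mul hlam0)
    ht₀ hF hg₀ hψ₀ hψ₂
  set A := √(lam * (1 - Real.exp (-lam)) / (2 * Real.pi)) with hA
  have hApos : 0 < A := by
    have : 0 < 1 - Real.exp (-lam) := sub_pos.2 (Real.exp_lt_one_iff.2 (by linarith))
    exact Real.sqrt_pos.2 (by positivity)
  set P : ℕ → ℝ := fun k => ∏ i ∈ Finset.range (k - 1), (1 - Real.exp (-lam / k) ^ (i + 1))⁻¹
    with hP
  have hmpos : ∀ n, (0 : ℝ) < m n := fun n => by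
    have := hm2 n
    exact_mod_cast (by omega : 0 < m n)
  have hPpos : ∀ n, 0 < P (m n) := fun n => prod_inv_pos (Real.exp_pos _)
    (Real.exp_lt_one_iff.2 (div_neg_of_neg_of_pos (by linarith) (hmpos n))) _
  set X : ℕ → ℝ := fun n => Real.exp (-lam / m n) ^ j n * P (m n) / m n with hX
  have hXpos : ∀ n, 0 < X n := fun n =>
    div_pos (mul_pos (pow_pos (Real.exp_pos _) _) (hPpos n)) (hmpos n)
  set T : ℕ → ℝ := fun n => ∑ l ∈ Finset.Icc 1 ((M n + 1).toNat),
    q ^ l * (numPart (l * m n - j n) (m n - 1) : ℝ) with hT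
  have hTX : Tendsto (fun n => T n / X n) atTop (nhds 1) := by
    rw [tendsto_iff_norm_sub_tendsto_zero]
    refine squeeze_zero (fun _ => norm_nonneg _) (fun n => ?_)
      (tendsto_relative_error hminf hq.1 hlam0
        (eventually_mul_le_truncation hm2 hmo hM (by positivity)))
    obtain ⟨hj1, hjm⟩ := residue_bounds (by have := hm2 n; omega) (hj n)
    have h := abs_sum_sub_le (hm2 n) hj1 hjm ((M n + 1).toNat) hlam0 hqe
    rw [div_sub_one (hXpos n).ne', Real.norm_eq_abs, abs_div, abs_of_pos (hXpos n),
      div_le_iff₀' (hXpos n)]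
    exact h
  have hlim := ((tendsto_prod_inv hlam0).comp hminf).div_const A
  rw [← hA, div_self hApos.ne'] at hlim
  have hprod := hTX.mul hlim
  rw [one_mul] at hprod
  refine hprod.congr fun n => ?_
  have hm' := hmpos n
  have hsplit : F / t₀ * Real.exp (lam / t₀ ^ 2 - ψ₀ - lam * (j n : ℝ) / (m n : ℝ)) *
      √(8 * Real.pi / |ψ₂|) = A * Real.exp (-lam / m n) ^ j n := by
    have : lam / t₀ ^ 2 - ψ₀ - lam * (j n : ℝ) / m n =
        (lam / t₀ ^ 2 - ψ₀) + (j n : ℝ) * (-lam / m n) := by ring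
    rw [← hconst, this, Real.exp_add, Real.exp_nat_mul]
    ring
  have hpow : (m n : ℝ) ^ ((3 : ℝ) / 2) = m n * √(m n) := by
    rw [Real.sqrt_eq_rpow, ← Real.rpow_one_add' hm'.le (by norm_num)]
    norm_num
  have hXn : X n = Real.exp (-lam / m n) ^ j n * P (m n) / m n := rfl
  have hP' := hPpos n
  have hs : 0 < √(m n : ℝ) := Real.sqrt_pos.2 hm'
  rw [hsplit, hpow, hXn]
  simp only [Function.comp_apply]
  rw [← hI, ← hψ, Real.exp_neg]
  change T n / _ * (P (m n) * √(m n : ℝ) * (Real.exp (m n * ψ₀))⁻¹ / A) = T n / _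
  field_simp
end
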